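/- arXiv:2512.02641 — 2 statements merged into one kernel-verified Lean document; each statement's English description precedes it below -/
import Mathlib

section
/- Let {T_n}_{n≥1} be a d-decaying Gauss-like iterated function system, let B ∈ (1,∞), let i_1 < ⋯ < i_k be an increasing finite sequence of integers, and let t_1,…,t_k be positive reals. Then the Hausdorff dimension of the set E = {x ∈ [0,1] : ∏_{m=1}^k a_{n+i_m}(x)^{t_m} ≥ B^n for infinitely many n ∈ ℕ} is at least s_0 = inf{s : P(s) ≤ A(s)·log B}. -/
open Set Filter Topology Metric MeasureTheory

noncomputable section

/-- The composition `T_{a_1} ∘ ⋯ ∘ T_{a_n}` of the maps along the word `ω = (a_1,…,a_n)`. -/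
def chainMap (T : ℕ+ → ℝ → ℝ) {n : ℕ} (ω : Fin n → ℕ+) (x : ℝ) : ℝ :=
  (List.ofFn ω).foldr (fun i y => T i y) x

/-- The chain-rule derivative of `chainMap T ω` at `x`, computed from the candidate
derivatives `T'` of the individual maps:
`(T_{a_1} ∘ ⋯ ∘ T_{a_n})'(x) = ∏_j T'_{a_j}(T_{a_{j+1}} ∘ ⋯ ∘ T_{a_n}(x))`. -/
def chainDeriv (T T' : ℕ+ → ℝ → ℝ) {n : ℕ} (ω : Fin n → ℕ+) (x : ℝ) : ℝ :=
  ((List.ofFn ω).foldr (fun i p => (T i p.1, T' i p.1 * p.2)) (x, (1 : ℝ))).2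

/-- A `d`-decaying Gauss-like iterated function system: a family `{T_i}_{i ≥ 1}` of
`C¹` self-maps of `[0,1]` (with derivative `T'`) satisfying the conditions (i)–(v). -/
structure GaussLikeIFS (d : ℝ) where
  one_lt_d : 1 < d
  T : ℕ+ → ℝ → ℝ
  T' : ℕ+ → ℝ → ℝ
  maps_to : ∀ i, Set.MapsTo (T i) (Set.Icc (0 : ℝ) 1) (Set.Icc (0 : ℝ) 1)
  hasDeriv : ∀ i, ∀ x ∈ Set.Icc (0 : ℝ) 1,
    HasDerivWithinAt (T i) (T' i x) (Set.Icc (0 : ℝ) 1) x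
  derivCont : ∀ i, ContinuousOn (T' i) (Set.Icc (0 : ℝ) 1)
  open_set_cond : ∀ i j : ℕ+, i ≠ j →
    T i '' Set.Ioo (0 : ℝ) 1 ∩ T j '' Set.Ioo (0 : ℝ) 1 = ∅
  covers : (⋃ i : ℕ+, T i '' Set.Icc (0 : ℝ) 1) = Set.Ico (0 : ℝ) 1
  ordered : ∀ i j : ℕ+, (∀ x ∈ Set.Ioo (0 : ℝ) 1, T i x < T j x) → i < j
  contracting : ∃ (m : ℕ) (h : ℝ), 0 < m ∧ 0 < h ∧ h < 1 ∧
    ∀ (a : Fin m → ℕ+), ∀ x ∈ Set.Icc (0 : ℝ) 1,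
      0 < |chainDeriv T T' a x| ∧ |chainDeriv T T' a x| ≤ h
  decay : ∀ ε : ℝ, 0 < ε → ∃ K₁ K₂ : ℝ, 0 < K₁ ∧ 0 < K₂ ∧
    ∀ i : ℕ+, ∃ ζ lam : ℝ,
      (∀ x ∈ Set.Icc (0 : ℝ) 1, ζ ≤ |T' i x| ∧ |T' i x| ≤ lam) ∧
      K₁ * ((i : ℕ) : ℝ) ^ (-(d + ε)) ≤ ζ ∧ ζ ≤ lam ∧
      lam ≤ K₂ * ((i : ℕ) : ℝ) ^ (-(d - ε))

namespace GaussLikeIFS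

variable {d : ℝ}

/-- The `n`-th level cylinder `C[ω] = T_{a_1} ∘ ⋯ ∘ T_{a_n}([0,1])`. -/
def cyl (S : GaussLikeIFS d) {n : ℕ} (ω : Fin n → ℕ+) : Set ℝ :=
  chainMap S.T ω '' Set.Icc 0 1

/-- The partition function `Z_n(s) = Σ_{ω ∈ ℕ^n} |C[ω]|^s`. -/
def Z (S : GaussLikeIFS d) (n : ℕ) (s : ℝ) : ℝ :=
  ∑' ω : Fin n → ℕ+, Metric.diam (S.cyl ω) ^ s

/-- `P_n(s) = (1/n) log Z_n(s)`. -/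
def Pn (S : GaussLikeIFS d) (n : ℕ) (s : ℝ) : ℝ :=
  (1 / (n : ℝ)) * Real.log (S.Z n s)

/-- The restricted partition function `Z_{M,n}(s) = Σ_{ω ∈ {1,…,M}^n} |C[ω]|^s`. -/
def ZM (S : GaussLikeIFS d) (M n : ℕ) (s : ℝ) : ℝ :=
  ∑' ω : {f : Fin n → ℕ+ // ∀ j, (f j : ℕ) ≤ M}, Metric.diam (S.cyl ω.1) ^ s

/-- `P_{M,n}(s) = (1/n) log Z_{M,n}(s)`. -/
def PMn (S : GaussLikeIFS d) (M n : ℕ) (s : ℝ) : ℝ :=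
  (1 / (n : ℝ)) * Real.log (S.ZM M n s)

/-- The set `E` of points of `[0,1]` admitting a symbolic expansion `a` such that
`∏_{m=1}^k a_{n+i_m}(x)^{t_m} ≥ B^n` for infinitely many `n`.
(Digits are indexed from `0` here, i.e. `a j` is the `(j+1)`-st digit.) -/
def Eset (S : GaussLikeIFS d) (B : ℝ) {k : ℕ} (i : Fin k → ℕ) (t : Fin k → ℝ) : Set ℝ :=
  {x | x ∈ Set.Icc (0 : ℝ) 1 ∧ ∃ a : ℕ → ℕ+,
    (∀ n : ℕ, x ∈ S.cyl (fun j : Fin n => a j.val)) ∧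
    (∃ᶠ n in Filter.atTop, B ^ n ≤ ∏ m, ((a (n + i m) : ℕ) : ℝ) ^ (t m))}

end GaussLikeIFS

/-- The simplex `S = {b : b_i ≥ 0, Σ b_i t_i = 1}`. -/
def simplexS {k : ℕ} (t : Fin k → ℝ) : Set (Fin k → ℝ) :=
  {b | (∀ i, 0 ≤ b i) ∧ ∑ i, b i * t i = 1}

/-- `A_m(b,s) = (d-1)·s·b_m + (d·s-1)·Σ_{j<m} b_j`. -/
def Am (d : ℝ) {k : ℕ} (b : Fin k → ℝ) (s : ℝ) (m : Fin k) : ℝ :=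
  (d - 1) * s * b m + (d * s - 1) * ∑ j ∈ Finset.Iio m, b j

/-- `A(b,s) = max_{1 ≤ m ≤ k} A_m(b,s)`. -/
def Afun (d : ℝ) {k : ℕ} (b : Fin k → ℝ) (s : ℝ) : ℝ :=
  ⨆ m, Am d b s m

/-- `A(s) = min_{b ∈ S} A(b,s)`. -/
def AS (d : ℝ) {k : ℕ} (t : Fin k → ℝ) (s : ℝ) : ℝ :=
  sInf ((fun b => Afun d b s) '' simplexS t)

namespace GaussLikeIFS

variable {d : ℝ}

/-- The composition of the maps of the system along a list of digits. -/
def wordMap (S : GaussLikeIFS d) (w : List ℕ+) (x : ℝ) : ℝ :=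
  w.foldr (fun i y => S.T i y) x

/-- The composition along `w` expands distances in `[0,1]` by a factor at least `r > 0`. -/
def Expands (S : GaussLikeIFS d) (w : List ℕ+) (r : ℝ) : Prop :=
  0 < r ∧ ∀ x ∈ Icc (0 : ℝ) 1, ∀ y ∈ Icc (0 : ℝ) 1,
    r * |x - y| ≤ |S.wordMap w x - S.wordMap w y|

lemma wordMap_nil (S : GaussLikeIFS d) (x : ℝ) : S.wordMap [] x = x := rfl

lemma wordMap_cons (S : GaussLikeIFS d) (i : ℕ+) (w : List ℕ+) (x : ℝ) :
    S.wordMap (i :: w) x = S.T i (S.wordMap w x) := rfl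

lemma wordMap_append (S : GaussLikeIFS d) (v w : List ℕ+) (x : ℝ) :
    S.wordMap (v ++ w) x = S.wordMap v (S.wordMap w x) := by
  simp [wordMap, List.foldr_append]

lemma cyl_eq_image (S : GaussLikeIFS d) {n : ℕ} (ω : Fin n → ℕ+) :
    S.cyl ω = S.wordMap (List.ofFn ω) '' Icc 0 1 := rfl

lemma wordMap_mem (S : GaussLikeIFS d) (w : List ℕ+) {x : ℝ} (hx : x ∈ Icc (0 : ℝ) 1) :
    S.wordMap w x ∈ Icc (0 : ℝ) 1 := by
  induction w with
  | nil => exact hx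
  | cons i w ih => exact S.maps_to i ih

lemma continuousOn_T (S : GaussLikeIFS d) (i : ℕ+) : ContinuousOn (S.T i) (Icc 0 1) :=
  fun x hx => (S.hasDeriv i x hx).continuousWithinAt

lemma continuousOn_wordMap (S : GaussLikeIFS d) (w : List ℕ+) :
    ContinuousOn (S.wordMap w) (Icc 0 1) := by
  induction w with
  | nil => exact continuousOn_id
  | cons i w ih => exact (S.continuousOn_T i).comp ih fun x hx => S.wordMap_mem w hx

lemma exists_slope (S : GaussLikeIFS d) (i : ℕ+) {x y : ℝ} (hx : x ∈ Icc (0 : ℝ) 1)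
    (hy : y ∈ Icc (0 : ℝ) 1) :
    ∃ z ∈ uIcc x y, S.T i x - S.T i y = S.T' i z * (x - y) := by
  wlog h : x ≤ y generalizing x y
  · obtain ⟨z, hz, e⟩ := this hy hx (le_of_not_ge h)
    exact ⟨z, by rwa [uIcc_comm], by linarith⟩
  rcases h.eq_or_lt with rfl | h
  · exact ⟨x, by simp, by simp⟩
  have sub : Icc x y ⊆ Icc 0 1 := Icc_subset_Icc hx.1 hy.2
  obtain ⟨z, hz, e⟩ := exists_hasDerivAt_eq_slope (S.T i) (S.T' i) h
    ((S.continuousOn_T i).mono sub) (fun z hz => (S.hasDeriv i z (sub ⟨hz.1.le, hz.2.le⟩)).hasDerivAt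
      (Icc_mem_nhds (hx.1.trans_lt hz.1) (hz.2.trans_le hy.2)))
  refine ⟨z, by rw [uIcc_of_le h.le]; exact ⟨hz.1.le, hz.2.le⟩, ?_⟩
  have : y - x ≠ 0 := by linarith
  rw [e]; field_simp; ring

lemma exists_deriv_bounds (S : GaussLikeIFS d) {ε : ℝ} (hε : 0 < ε) :
    ∃ K₁ K₂ : ℝ, 0 < K₁ ∧ 0 < K₂ ∧ ∀ i : ℕ+, ∀ x ∈ Icc (0 : ℝ) 1,
      K₁ * ((i : ℕ) : ℝ) ^ (-(d + ε)) ≤ |S.T' i x| ∧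
      |S.T' i x| ≤ K₂ * ((i : ℕ) : ℝ) ^ (-(d - ε)) := by
  obtain ⟨K₁, K₂, h1, h2, h⟩ := S.decay ε hε
  refine ⟨K₁, K₂, h1, h2, fun i x hx => ?_⟩
  obtain ⟨a, b, hab, h3, -, h4⟩ := h i
  exact ⟨h3.trans (hab x hx).1, (hab x hx).2.trans h4⟩

lemma Expands.mono {S : GaussLikeIFS d} {w : List ℕ+} {r r' : ℝ} (h : S.Expands w r)
    (h0 : 0 < r') (hr : r' ≤ r) : S.Expands w r' :=
  ⟨h0, fun x hx y hy => (mul_le_mul_of_nonneg_right hr (abs_nonneg _)).trans (h.2 x hx y hy)⟩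

lemma expands_nil (S : GaussLikeIFS d) : S.Expands [] 1 :=
  ⟨one_pos, fun x _ y _ => by simp [wordMap_nil]⟩

lemma Expands.append {S : GaussLikeIFS d} {v w : List ℕ+} {r r' : ℝ} (h : S.Expands v r)
    (h' : S.Expands w r') : S.Expands (v ++ w) (r * r') := by
  refine ⟨mul_pos h.1 h'.1, fun x hx y hy => ?_⟩
  rw [wordMap_append, wordMap_append, mul_assoc]
  exact (mul_le_mul_of_nonneg_left (h'.2 x hx y hy) h.1.le).trans
    (h.2 _ (S.wordMap_mem w hx) _ (S.wordMap_mem w hy))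

lemma Expands.le_one {S : GaussLikeIFS d} {w : List ℕ+} {r : ℝ} (h : S.Expands w r) :
    r ≤ 1 := by
  have h1 := h.2 1 (by simp) 0 (by simp)
  have h2 := S.wordMap_mem w (x := 1) (by simp)
  have h3 := S.wordMap_mem w (x := 0) (by simp)
  have : |S.wordMap w 1 - S.wordMap w 0| ≤ 1 :=
    abs_le.2 ⟨by linarith [h2.1, h3.2], by linarith [h2.2, h3.1]⟩
  simp at h1; linarith

lemma Expands.injOn {S : GaussLikeIFS d} {w : List ℕ+} {r : ℝ} (h : S.Expands w r) :
    InjOn (S.wordMap w) (Icc 0 1) := by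
  intro x hx y hy e
  have h1 := h.2 x hx y hy
  rw [e, sub_self, abs_zero] at h1
  have : |x - y| ≤ 0 := by
    by_contra! h2
    linarith [mul_pos h.1 h2]
  exact sub_eq_zero.1 (abs_nonpos_iff.1 this)

lemma expands_singleton (S : GaussLikeIFS d) {i : ℕ+} {r : ℝ} (hr : 0 < r)
    (h : ∀ x ∈ Icc (0 : ℝ) 1, r ≤ |S.T' i x|) : S.Expands [i] r := by
  refine ⟨hr, fun x hx y hy => ?_⟩
  obtain ⟨z, hz, e⟩ := S.exists_slope i hx hy
  simp only [wordMap_cons, wordMap_nil]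
  rw [e, abs_mul]
  have hz' : z ∈ Icc (0 : ℝ) 1 := (Set.OrdConnected.uIcc_subset ordConnected_Icc hx hy) hz
  gcongr
  exact h z hz'

lemma exists_expands_singleton (S : GaussLikeIFS d) (i : ℕ+) : ∃ r, S.Expands [i] r := by
  obtain ⟨K₁, K₂, h1, -, h⟩ := S.exists_deriv_bounds one_pos
  have : (0 : ℝ) < ((i : ℕ) : ℝ) := by exact_mod_cast i.pos
  exact ⟨_, S.expands_singleton (by positivity) fun x hx => (h i x hx).1⟩

lemma exists_expands (S : GaussLikeIFS d) (w : List ℕ+) : ∃ r, S.Expands w r := by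
  induction w with
  | nil => exact ⟨_, S.expands_nil⟩
  | cons i w ih =>
    obtain ⟨r, hr⟩ := ih
    obtain ⟨q, hq⟩ := S.exists_expands_singleton i
    exact ⟨_, hq.append hr⟩

lemma injOn_T (S : GaussLikeIFS d) (i : ℕ+) : InjOn (S.T i) (Icc 0 1) :=
  (S.exists_expands_singleton i).choose_spec.injOn

lemma strictMonoOn_or_strictAntiOn (S : GaussLikeIFS d) (w : List ℕ+) :
    StrictMonoOn (S.wordMap w) (Icc 0 1) ∨ StrictAntiOn (S.wordMap w) (Icc 0 1) :=
  ContinuousOn.strictMonoOn_of_injOn_Icc' zero_le_one (S.continuousOn_wordMap w)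
    (S.exists_expands w).choose_spec.injOn

lemma wordMap_mem_Ioo (S : GaussLikeIFS d) (w : List ℕ+) {x : ℝ} (hx : x ∈ Ioo (0 : ℝ) 1) :
    S.wordMap w x ∈ Ioo (0 : ℝ) 1 := by
  have h0 : (0 : ℝ) ∈ Icc (0 : ℝ) 1 := by simp
  have h1 : (1 : ℝ) ∈ Icc (0 : ℝ) 1 := by simp
  have hx' := Ioo_subset_Icc_self hx
  have m0 := S.wordMap_mem w h0
  have m1 := S.wordMap_mem w h1
  rcases S.strictMonoOn_or_strictAntiOn w with h | h
  · exact ⟨m0.1.trans_lt (h h0 hx' hx.1), (h hx' h1 hx.2).trans_le m1.2⟩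
  · exact ⟨m1.1.trans_lt (h hx' h1 hx.2), (h h0 hx' hx.1).trans_le m0.2⟩

lemma wordMap_ne (S : GaussLikeIFS d) {v w : List ℕ+} (hl : v.length = w.length) (hne : v ≠ w)
    {x y : ℝ} (hx : x ∈ Ioo (0 : ℝ) 1) (hy : y ∈ Ioo (0 : ℝ) 1) :
    S.wordMap v x ≠ S.wordMap w y := by
  induction v generalizing w with
  | nil => cases w <;> simp_all
  | cons i v ih =>
    cases w with
    | nil => simp at hl
    | cons j w =>
      intro e
      rw [wordMap_cons, wordMap_cons] at e
      have hv := S.wordMap_mem_Ioo v hx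
      have hw := S.wordMap_mem_Ioo w hy
      by_cases hij : i = j
      · subst hij
        exact ih (by simpa using hl) (by simpa using hne)
          (S.injOn_T i (Ioo_subset_Icc_self hv) (Ioo_subset_Icc_self hw) e)
      · have := S.open_set_cond i j hij
        have h2 : S.T i (S.wordMap v x) ∈ S.T i '' Ioo 0 1 ∩ S.T j '' Ioo 0 1 :=
          ⟨⟨_, hv, rfl⟩, ⟨_, hw, e.symm⟩⟩
        rw [this] at h2
        exact h2

/-- A point outside the open image of a word stays away from the image of the middle part. -/
lemma Expands.mul_le_abs_sub {S : GaussLikeIFS d} {w : List ℕ+} {r η z v : ℝ}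
    (h : S.Expands w r) (hη : 0 < η) (hz : η ≤ z) (hz' : z ≤ 1 - η)
    (hv : ∀ y ∈ Ioo (0 : ℝ) 1, S.wordMap w y ≠ v) : η * r ≤ |S.wordMap w z - v| := by
  by_contra! hlt
  have h0 : (0 : ℝ) ∈ Icc (0 : ℝ) 1 := by simp
  have h1 : (1 : ℝ) ∈ Icc (0 : ℝ) 1 := by simp
  have hzI : z ∈ Icc (0 : ℝ) 1 := ⟨by linarith, by linarith⟩
  have e0 := h.2 z hzI 0 h0
  have e1 := h.2 z hzI 1 h1
  have hr := h.1
  rw [abs_of_nonneg (by linarith : (0 : ℝ) ≤ z - 0)] at e0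
  rw [abs_of_nonpos (by linarith : z - 1 ≤ 0)] at e1
  have e0' : η * r ≤ |S.wordMap w z - S.wordMap w 0| := by nlinarith
  have e1' : η * r ≤ |S.wordMap w z - S.wordMap w 1| := by nlinarith
  have hlt' := abs_lt.1 hlt
  rcases S.strictMonoOn_or_strictAntiOn w with hm | hm
  · have i0 := hm h0 hzI (by linarith)
    have i1 := hm hzI h1 (by linarith)
    rw [abs_of_pos (by linarith)] at e0'
    rw [abs_of_neg (by linarith)] at e1'
    obtain ⟨y, hy, e⟩ := intermediate_value_Ioo zero_le_one (S.continuousOn_wordMap w)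
      (show v ∈ Ioo _ _ from ⟨by linarith, by linarith⟩)
    exact hv y hy e
  · have i0 := hm h0 hzI (by linarith)
    have i1 := hm hzI h1 (by linarith)
    rw [abs_of_neg (by linarith)] at e0'
    rw [abs_of_pos (by linarith)] at e1'
    obtain ⟨y, hy, e⟩ := intermediate_value_Ioo' zero_le_one (S.continuousOn_wordMap w)
      (show v ∈ Ioo _ _ from ⟨by linarith, by linarith⟩)
    exact hv y hy e

/-- The images of the maps are ordered by the index. -/
lemma T_le_T (S : GaussLikeIFS d) {i j : ℕ+} (hij : i < j) {x y : ℝ}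
    (hx : x ∈ Icc (0 : ℝ) 1) (hy : y ∈ Icc (0 : ℝ) 1) : S.T i x ≤ S.T j y := by
  have hIoo : ∀ p ∈ Ioo (0 : ℝ) 1 ×ˢ Ioo (0 : ℝ) 1, S.T i p.1 - S.T j p.2 ≤ 0 := by
    have hc : ContinuousOn (fun p : ℝ × ℝ => S.T i p.1 - S.T j p.2)
        (Ioo (0 : ℝ) 1 ×ˢ Ioo (0 : ℝ) 1) :=
      (((S.continuousOn_T i).mono Ioo_subset_Icc_self).comp continuousOn_fst fun p hp => hp.1).sub
        (((S.continuousOn_T j).mono Ioo_subset_Icc_self).comp continuousOn_snd fun p hp => hp.2)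
    have hpre : IsPreconnected (Ioo (0 : ℝ) 1 ×ˢ Ioo (0 : ℝ) 1) :=
      isPreconnected_Ioo.prod isPreconnected_Ioo
    have hne : ∀ p ∈ Ioo (0 : ℝ) 1 ×ˢ Ioo (0 : ℝ) 1, S.T i p.1 - S.T j p.2 ≠ 0 := by
      intro p hp e
      exact S.wordMap_ne (v := [i]) (w := [j]) rfl (by simpa using hij.ne) hp.1 hp.2
        (sub_eq_zero.1 e)
    intro p hp
    by_contra! hpos
    refine absurd (S.ordered j i fun z hz => ?_) (not_lt.2 hij.le)
    by_contra! hz2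
    obtain ⟨q, hq, e⟩ := hpre.intermediate_value (a := (z, z)) (b := p) ⟨hz, hz⟩ hp hc
      (show (0 : ℝ) ∈ Icc _ _ from ⟨by simpa using hz2, hpos.le⟩)
    exact hne q hq e
  have hcl : closure (Ioo (0 : ℝ) 1 ×ˢ Ioo (0 : ℝ) 1) = Icc (0 : ℝ) 1 ×ˢ Icc (0 : ℝ) 1 := by
    rw [closure_prod_eq, closure_Ioo (by norm_num)]
  have hc : ContinuousOn (fun p : ℝ × ℝ => S.T i p.1 - S.T j p.2)
      (Icc (0 : ℝ) 1 ×ˢ Icc (0 : ℝ) 1) :=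
    ((S.continuousOn_T i).comp continuousOn_fst fun p hp => hp.1).sub
      ((S.continuousOn_T j).comp continuousOn_snd fun p hp => hp.2)
  have hp : ((x, y) : ℝ × ℝ) ∈ Icc (0 : ℝ) 1 ×ˢ Icc (0 : ℝ) 1 := ⟨hx, hy⟩
  have := ContinuousWithinAt.closure_le (s := Ioo (0 : ℝ) 1 ×ˢ Ioo (0 : ℝ) 1) (x := (x, y))
    (f := fun p : ℝ × ℝ => S.T i p.1 - S.T j p.2) (g := fun _ => 0) (by rw [hcl]; exact hp)
    ((hc _ hp).mono (prod_mono Ioo_subset_Icc_self Ioo_subset_Icc_self))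
    continuousWithinAt_const hIoo
  simpa using this

/-- Some map of the system sends `[0,1]` into a compact subset of `(0,1)`. -/
lemma exists_interior_digit (S : GaussLikeIFS d) :
    ∃ (p : ℕ+) (η : ℝ), 0 < η ∧ ∀ x ∈ Icc (0 : ℝ) 1, η ≤ S.T p x ∧ S.T p x ≤ 1 - η := by
  have h0 : (0 : ℝ) ∈ Icc (0 : ℝ) 1 := by simp
  have h1 : (1 : ℝ) ∈ Icc (0 : ℝ) 1 := by simp
  obtain ⟨z, hz, hmax⟩ := isCompact_Icc.exists_isMaxOn ⟨0, h0⟩ (S.continuousOn_T 2)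
  have hz1 : S.T 2 z < 1 := by
    have : S.T 2 z ∈ Ico (0 : ℝ) 1 := by
      rw [← S.covers]
      exact mem_iUnion.2 ⟨2, z, hz, rfl⟩
    exact this.2
  obtain ⟨y, hy, hypos⟩ : ∃ y ∈ Icc (0 : ℝ) 1, 0 < S.T 1 y := by
    by_contra! hcon
    have e0 := le_antisymm (hcon 0 h0) (S.maps_to 1 h0).1
    have e1 := le_antisymm (hcon 1 h1) (S.maps_to 1 h1).1
    exact zero_ne_one (S.injOn_T 1 h0 h1 (e0.trans e1.symm))
  refine ⟨2, min (S.T 1 y) (1 - S.T 2 z), lt_min hypos (by linarith), fun x hx => ⟨?_, ?_⟩⟩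
  · exact (min_le_left _ _).trans (S.T_le_T (by decide) hy hx)
  · have h3 : S.T 2 x ≤ S.T 2 z := hmax hx
    linarith [min_le_right (S.T 1 y) (1 - S.T 2 z)]

end GaussLikeIFS

namespace GaussLikeIFS

variable {d : ℝ}

/-- One stage of a Cantor construction: a parameter `u ∈ [0,1)` selects a word of fixed length and
a new parameter. The number `φ` bounds the quotient of the mass of the selected word and the
`s`-th power of its expansion factor; `κ` is the constant in the separation estimate for
parameters selecting different words. -/
structure Step (S : GaussLikeIFS d) (s : ℝ) where
  len : ℕ
  φ : ℝ
  κ : ℝ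
  φ_nonneg : 0 ≤ φ
  word : ℝ → List ℕ+
  next : ℝ → ℝ
  length_word : ∀ u ∈ Ico (0 : ℝ) 1, (word u).length = len
  next_mem : ∀ u ∈ Ico (0 : ℝ) 1, next u ∈ Ico (0 : ℝ) 1
  same : ∀ u ∈ Ico (0 : ℝ) 1, ∀ v ∈ Ico (0 : ℝ) 1, word u = word v →
    ∃ r, S.Expands (word u) r ∧ |u - v| ≤ φ * r ^ s * |next u - next v|
  diff : ∀ u ∈ Ico (0 : ℝ) 1, ∀ v ∈ Ico (0 : ℝ) 1, word u ≠ word v →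
    ∀ x ∈ Icc (0 : ℝ) 1, ∀ y ∈ Icc (0 : ℝ) 1,
      |u - v| ≤ κ * |S.wordMap (word u) x - S.wordMap (word v) y| ^ s

namespace Step

variable {S : GaussLikeIFS d} {s : ℝ}

/-- The stage that selects nothing. -/
def nil (S : GaussLikeIFS d) (s : ℝ) : Step S s where
  len := 0
  φ := 1
  κ := 0
  φ_nonneg := zero_le_one
  word _ := []
  next u := u
  length_word _ _ := rfl
  next_mem _ h := h
  same u _ v _ _ := ⟨1, S.expands_nil, by simp⟩
  diff u _ v _ h := absurd rfl h

/-- The composition of two stages. -/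
def comp (hs : 0 ≤ s) (a b : Step S s) : Step S s where
  len := a.len + b.len
  φ := a.φ * b.φ
  κ := max a.κ (a.φ * b.κ)
  φ_nonneg := mul_nonneg a.φ_nonneg b.φ_nonneg
  word u := a.word u ++ b.word (a.next u)
  next u := b.next (a.next u)
  length_word u hu := by
    rw [List.length_append, a.length_word u hu, b.length_word _ (a.next_mem u hu)]
  next_mem u hu := b.next_mem _ (a.next_mem u hu)
  same u hu v hv h := by
    obtain ⟨h1, h2⟩ := List.append_inj h ((a.length_word u hu).trans (a.length_word v hv).symm)
    obtain ⟨r, hr, e⟩ := a.same u hu v hv h1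
    obtain ⟨q, hq, e'⟩ := b.same _ (a.next_mem u hu) _ (a.next_mem v hv) h2
    refine ⟨r * q, hr.append hq, e.trans ?_⟩
    have h3 : 0 ≤ a.φ * r ^ s := mul_nonneg a.φ_nonneg (Real.rpow_nonneg hr.1.le _)
    calc _ ≤ a.φ * r ^ s * (b.φ * q ^ s * |b.next (a.next u) - b.next (a.next v)|) :=
          mul_le_mul_of_nonneg_left e' h3
      _ = _ := by rw [Real.mul_rpow hr.1.le hq.1.le]; ring
  diff u hu v hv h x hx y hy := by
    rw [wordMap_append, wordMap_append]
    by_cases h1 : a.word u = a.word v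
    · have h2 : b.word (a.next u) ≠ b.word (a.next v) := fun h2 => h (by rw [h1, h2])
      obtain ⟨r, hr, e⟩ := a.same u hu v hv h1
      have e' := b.diff _ (a.next_mem u hu) _ (a.next_mem v hv) h2 x hx y hy
      have e'' := hr.2 _ (S.wordMap_mem (b.word (a.next u)) hx) _
        (S.wordMap_mem (b.word (a.next v)) hy)
      rw [← h1]
      have h3 : 0 ≤ a.φ * r ^ s := mul_nonneg a.φ_nonneg (Real.rpow_nonneg hr.1.le _)
      set X := S.wordMap (b.word (a.next u)) x
      set Y := S.wordMap (b.word (a.next v)) y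
      have e3 : (r * |X - Y|) ^ s ≤ |S.wordMap (a.word u) X - S.wordMap (a.word u) Y| ^ s :=
        Real.rpow_le_rpow (mul_nonneg hr.1.le (abs_nonneg _)) e'' hs
      by_cases hb : 0 ≤ b.κ
      · calc _ ≤ a.φ * r ^ s * (b.κ * |X - Y| ^ s) := e.trans (mul_le_mul_of_nonneg_left e' h3)
          _ = (a.φ * b.κ) * (r * |X - Y|) ^ s := by
            rw [Real.mul_rpow hr.1.le (abs_nonneg _)]; ring
          _ ≤ (a.φ * b.κ) * |S.wordMap (a.word u) X - S.wordMap (a.word u) Y| ^ s :=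
            mul_le_mul_of_nonneg_left e3 (mul_nonneg a.φ_nonneg hb)
          _ ≤ _ := mul_le_mul_of_nonneg_right (le_max_right _ _)
            (Real.rpow_nonneg (abs_nonneg _) _)
      · have h4 : b.κ * |X - Y| ^ s ≤ 0 :=
          mul_nonpos_of_nonpos_of_nonneg (not_le.1 hb).le (Real.rpow_nonneg (abs_nonneg _) _)
        have h5 : |u - v| ≤ 0 := e.trans
          (mul_nonpos_of_nonneg_of_nonpos h3 (e'.trans h4))
        have huv : u = v := sub_eq_zero.1 (abs_nonpos_iff.1 h5)
        subst huv
        exact absurd rfl h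
    · exact (a.diff u hu v hv h1 _ (S.wordMap_mem _ hx) _ (S.wordMap_mem _ hy)).trans
        (mul_le_mul_of_nonneg_right (le_max_left _ _) (Real.rpow_nonneg (abs_nonneg _) _))

/-- The parameter reached from `y` after `l` stages. -/
def orbit (st : ℕ → Step S s) (y : ℝ) : ℕ → ℝ
  | 0 => y
  | l + 1 => (st l).next (orbit st y l)

/-- The word selected by `y` in the first `l` stages. -/
def pref (st : ℕ → Step S s) (y : ℝ) : ℕ → List ℕ+
  | 0 => []
  | l + 1 => pref st y l ++ (st l).word (orbit st y l)

lemma orbit_mem (st : ℕ → Step S s) {y : ℝ} (hy : y ∈ Ico (0 : ℝ) 1) (l : ℕ) :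
    orbit st y l ∈ Ico (0 : ℝ) 1 := by
  induction l with
  | zero => exact hy
  | succ l ih => exact (st l).next_mem _ ih

lemma length_pref (st : ℕ → Step S s) {y : ℝ} (hy : y ∈ Ico (0 : ℝ) 1) (l : ℕ) :
    (pref st y l).length = ∑ j ∈ Finset.range l, (st j).len := by
  induction l with
  | zero => rfl
  | succ l ih =>
    rw [pref, List.length_append, ih, (st l).length_word _ (orbit_mem st hy l),
      Finset.sum_range_succ]

lemma pref_prefix (st : ℕ → Step S s) (y : ℝ) {l l' : ℕ} (h : l ≤ l') :
    pref st y l <+: pref st y l' := by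
  induction l', h using Nat.le_induction with
  | base => exact List.prefix_rfl
  | succ n _ ih => exact ih.trans (List.prefix_append _ _)

lemma abs_sub_le_of_pref_eq (st : ℕ → Step S s) {y z : ℝ} (hy : y ∈ Ico (0 : ℝ) 1)
    (hz : z ∈ Ico (0 : ℝ) 1) (l : ℕ) (h : pref st y l = pref st z l) :
    ∃ r, S.Expands (pref st y l) r ∧
      |y - z| ≤ (∏ j ∈ Finset.range l, (st j).φ) * r ^ s * |orbit st y l - orbit st z l| := by
  induction l with
  | zero => exact ⟨1, S.expands_nil, by simp [orbit]⟩
  | succ l ih =>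
    obtain ⟨h1, h2⟩ := List.append_inj h ((length_pref st hy l).trans (length_pref st hz l).symm)
    obtain ⟨r, hr, e⟩ := ih h1
    obtain ⟨q, hq, e'⟩ := (st l).same _ (orbit_mem st hy l) _ (orbit_mem st hz l) h2
    refine ⟨r * q, hr.append hq, e.trans ?_⟩
    have h3 : 0 ≤ (∏ j ∈ Finset.range l, (st j).φ) * r ^ s :=
      mul_nonneg (Finset.prod_nonneg fun j _ => (st j).φ_nonneg) (Real.rpow_nonneg hr.1.le _)
    refine (mul_le_mul_of_nonneg_left e' h3).trans (le_of_eq ?_)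
    rw [Real.mul_rpow hr.1.le hq.1.le, Finset.prod_range_succ]
    simp only [orbit]
    ring

lemma exists_mem_iInter_pref (st : ℕ → Step S s) (y : ℝ) :
    ∃ x : ℝ, ∀ l, x ∈ S.wordMap (pref st y l) '' Icc 0 1 := by
  have := IsCompact.nonempty_iInter_of_sequence_nonempty_isCompact_isClosed
    (fun l => S.wordMap (pref st y l) '' Icc 0 1) (fun l => ?_)
    (fun l => ⟨_, 0, by simp, rfl⟩)
    (isCompact_Icc.image_of_continuousOn (S.continuousOn_wordMap _))
    (fun l => (isCompact_Icc.image_of_continuousOn (S.continuousOn_wordMap _)).isClosed)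
  · obtain ⟨x, hx⟩ := this
    exact ⟨x, fun l => mem_iInter.1 hx l⟩
  · rintro _ ⟨x, hx, rfl⟩
    exact ⟨S.wordMap ((st l).word (orbit st y l)) x, S.wordMap_mem _ hx,
      by rw [pref, wordMap_append]⟩

lemma abs_sub_le_of_mem (st : ℕ → Step S s) (hs : 0 ≤ s) {C : ℝ} (hC0 : 0 ≤ C)
    (hC : ∀ l, (∏ j ∈ Finset.range l, (st j).φ) * (st l).κ ≤ C)
    (hφ : Tendsto (fun l => ∏ j ∈ Finset.range l, (st j).φ) atTop (𝓝 0))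
    {y z : ℝ} (hy : y ∈ Ico (0 : ℝ) 1) (hz : z ∈ Ico (0 : ℝ) 1) {x x' : ℝ}
    (hx : ∀ l, x ∈ S.wordMap (pref st y l) '' Icc 0 1)
    (hx' : ∀ l, x' ∈ S.wordMap (pref st z l) '' Icc 0 1) :
    |y - z| ≤ C * |x - x'| ^ s := by
  have hRn : 0 ≤ C * |x - x'| ^ s := mul_nonneg hC0 (Real.rpow_nonneg (abs_nonneg _) _)
  by_cases hall : ∀ l, pref st y l = pref st z l
  · refine le_trans ?_ hRn
    refine ge_of_tendsto hφ (Eventually.of_forall fun l => ?_)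
    obtain ⟨r, hr, e⟩ := abs_sub_le_of_pref_eq st hy hz l (hall l)
    have h0 : 0 ≤ ∏ j ∈ Finset.range l, (st j).φ := Finset.prod_nonneg fun j _ => (st j).φ_nonneg
    have h1 : r ^ s ≤ 1 := Real.rpow_le_one hr.1.le hr.le_one hs
    have h1' : 0 ≤ r ^ s := Real.rpow_nonneg hr.1.le _
    have h2 : |orbit st y l - orbit st z l| ≤ 1 := by
      have a := orbit_mem st hy l
      have b := orbit_mem st hz l
      exact abs_le.2 ⟨by linarith [a.1, b.2], by linarith [a.2, b.1]⟩
    calc _ ≤ _ := e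
      _ ≤ (∏ j ∈ Finset.range l, (st j).φ) * 1 * 1 := by gcongr
      _ = _ := by ring
  · push Not at hall
    classical
    obtain ⟨l, hl⟩ : ∃ l, Nat.find hall = l + 1 := by
      refine Nat.exists_eq_succ_of_ne_zero fun h0 => ?_
      have := Nat.find_spec hall
      rw [h0] at this
      exact this rfl
    have hne := Nat.find_spec hall
    have heq : pref st y l = pref st z l := by
      by_contra h
      exact Nat.find_min hall (m := l) (by omega) h
    rw [hl] at hne
    have hw : (st l).word (orbit st y l) ≠ (st l).word (orbit st z l) := by
      intro h
      exact hne (by rw [pref, pref, heq, h])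
    obtain ⟨r, hr, e⟩ := abs_sub_le_of_pref_eq st hy hz l heq
    obtain ⟨v, hv, rfl⟩ := hx (l + 1)
    obtain ⟨v', hv', rfl⟩ := hx' (l + 1)
    have hd := (st l).diff _ (orbit_mem st hy l) _ (orbit_mem st hz l) hw v hv v' hv'
    simp only [pref, wordMap_append] at *
    rw [← heq]
    set X := S.wordMap ((st l).word (orbit st y l)) v with hX
    set Y := S.wordMap ((st l).word (orbit st z l)) v' with hY
    have e'' := hr.2 X (S.wordMap_mem _ hv) Y (S.wordMap_mem _ hv')
    have h0 : 0 ≤ ∏ j ∈ Finset.range l, (st j).φ := Finset.prod_nonneg fun j _ => (st j).φ_nonneg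
    calc |y - z| ≤ _ := e
      _ ≤ (∏ j ∈ Finset.range l, (st j).φ) * r ^ s * ((st l).κ * |X - Y| ^ s) :=
        mul_le_mul_of_nonneg_left hd (mul_nonneg h0 (Real.rpow_nonneg hr.1.le _))
      _ = ((∏ j ∈ Finset.range l, (st j).φ) * (st l).κ) * (r * |X - Y|) ^ s := by
        rw [Real.mul_rpow hr.1.le (abs_nonneg _)]; ring
      _ ≤ C * (r * |X - Y|) ^ s :=
        mul_le_mul_of_nonneg_right (hC l)
          (Real.rpow_nonneg (mul_nonneg hr.1.le (abs_nonneg _)) _)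
      _ ≤ _ := mul_le_mul_of_nonneg_left
        (Real.rpow_le_rpow (mul_nonneg hr.1.le (abs_nonneg _)) e'' hs) hC0

end Step

/-- A set containing the image of an inverse Hölder map defined on `[0,1)` has large dimension. -/
lemma ofReal_le_dimH_of_abs_sub_le {A : Set ℝ} {f : ℝ → ℝ} {s C : ℝ} (hs : 0 < s)
    (hf : ∀ y ∈ Ico (0 : ℝ) 1, f y ∈ A)
    (h : ∀ y ∈ Ico (0 : ℝ) 1, ∀ z ∈ Ico (0 : ℝ) 1, |y - z| ≤ C * |f y - f z| ^ s) :
    ENNReal.ofReal s ≤ dimH A := by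
  have hinj : InjOn f (Ico 0 1) := by
    intro y hy z hz e
    have := h y hy z hz
    rw [e, sub_self, abs_zero, Real.zero_rpow hs.ne', mul_zero] at this
    exact sub_eq_zero.1 (abs_nonpos_iff.1 this)
  set g := Function.invFunOn f (Ico 0 1) with hg
  have hgf : ∀ y ∈ Ico (0 : ℝ) 1, g (f y) = y := fun y hy => hinj.leftInvOn_invFunOn hy
  have hhol : HolderOnWith C.toNNReal s.toNNReal g (f '' Ico 0 1) := by
    rintro _ ⟨y, hy, rfl⟩ _ ⟨z, hz, rfl⟩
    rw [hgf y hy, hgf z hz, edist_dist, edist_dist, Real.dist_eq, Real.dist_eq,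
      Real.coe_toNNReal _ hs.le, ENNReal.ofReal_rpow_of_nonneg (abs_nonneg _) hs.le]
    change _ ≤ ENNReal.ofReal C * _
    rw [← ENNReal.ofReal_mul' (Real.rpow_nonneg (abs_nonneg _) _)]
    exact ENNReal.ofReal_le_ofReal (h y hy z hz)
  have himg : g '' (f '' Ico 0 1) = Ico 0 1 := by
    rw [image_image]
    ext y
    constructor
    · rintro ⟨z, hz, rfl⟩
      change g (f z) ∈ _
      rwa [hgf z hz]
    · exact fun hy => ⟨y, hy, hgf y hy⟩
  have h1 := hhol.dimH_image_le (by simpa using hs)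
  rw [himg, Real.dimH_of_nonempty_interior (by simp)] at h1
  have h2 := ENNReal.mul_le_of_le_div h1
  rw [Module.finrank_self, Nat.cast_one, one_mul] at h2
  refine le_trans h2 (dimH_mono ?_)
  rintro _ ⟨y, hy, rfl⟩
  exact hf y hy

/-- Dimension of the limit set of a Cantor construction. -/
lemma Step.ofReal_le_dimH {S : GaussLikeIFS d} {s : ℝ} (st : ℕ → Step S s) (hs : 0 < s) {C : ℝ}
    (hC0 : 0 ≤ C) (hlen : ∀ l, 0 < (st l).len)
    (hC : ∀ l, (∏ j ∈ Finset.range l, (st j).φ) * (st l).κ ≤ C)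
    (hφ : Tendsto (fun l => ∏ j ∈ Finset.range l, (st j).φ) atTop (𝓝 0))
    {A : Set ℝ}
    (hA : ∀ u : ℕ → ℝ, (∀ l, u l ∈ Ico (0 : ℝ) 1) → ∀ a : ℕ → ℕ+, ∀ x ∈ Icc (0 : ℝ) 1,
      (∀ n : ℕ, x ∈ S.cyl (fun j : Fin n => a j.val)) →
      (∀ l j, j < (st l).len →
        ((st l).word (u l))[j]? = some (a (∑ i ∈ Finset.range l, (st i).len + j))) → x ∈ A) :
    ENNReal.ofReal s ≤ dimH A := by
  choose f hf using Step.exists_mem_iInter_pref st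
  refine ofReal_le_dimH_of_abs_sub_le (f := f) (C := C) hs (fun y hy => ?_)
    (fun y hy z hz => Step.abs_sub_le_of_mem st hs.le hC0 hC hφ hy hz (hf y) (hf z))
  have hlen_le : ∀ l, l ≤ (Step.pref st y l).length := by
    intro l
    rw [Step.length_pref st hy]
    calc l = ∑ j ∈ Finset.range l, 1 := by simp
      _ ≤ _ := Finset.sum_le_sum fun j _ => hlen j
  have hex : ∀ n, ∃ c, (Step.pref st y (n + 1))[n]? = some c := fun n =>
    ⟨_, List.getElem?_eq_getElem (by have := hlen_le (n + 1); omega)⟩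
  choose a ha using hex
  have ha' : ∀ l n, n < (Step.pref st y l).length → (Step.pref st y l)[n]? = some (a n) := by
    intro l n hn
    rcases le_total l (n + 1) with h | h
    · rw [← ha n]
      exact (List.prefix_iff_getElem?.1 (Step.pref_prefix st y h) n hn).symm ▸
        List.getElem?_eq_getElem hn
    · rw [← ha n]
      have hn' := hlen_le (n + 1)
      exact (List.prefix_iff_getElem?.1 (Step.pref_prefix st y h) n (by omega)).trans
        (List.getElem?_eq_getElem (by omega)).symm
  refine hA (Step.orbit st y) (Step.orbit_mem st hy) a (f y) ?_ (fun n => ?_) (fun l j hj => ?_)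
  · obtain ⟨x, hx, e⟩ := hf y 0
    exact e ▸ S.wordMap_mem _ hx
  · obtain ⟨x, hx, e⟩ := hf y n
    have htake : List.ofFn (fun j : Fin n => a j.val) = (Step.pref st y n).take n := by
      refine List.ext_getElem? fun m => ?_
      by_cases hm : m < n
      · rw [List.getElem?_take_of_lt hm, ha' n m (hm.trans_le (hlen_le n))]
        simp [hm]
      · rw [List.getElem?_eq_none (by simpa using hm),
          List.getElem?_eq_none (by simp; omega)]
    rw [cyl_eq_image, htake, ← e]
    refine ⟨S.wordMap ((Step.pref st y n).drop n) x, S.wordMap_mem _ hx, ?_⟩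
    rw [← wordMap_append, List.take_append_drop]
  · have h1 := Step.length_pref st hy l
    have hlw := (st l).length_word _ (Step.orbit_mem st hy l)
    have h2 := ha' (l + 1) (∑ i ∈ Finset.range l, (st i).len + j) (by
      rw [Step.pref, List.length_append, h1, hlw]; omega)
    rw [← h2, Step.pref, List.getElem?_append_right (by omega)]
    congr 1
    omega

end GaussLikeIFS

/-- Subdivision of `[0, ∑ p)` into consecutive intervals of lengths `p a`, each rescaled
to `[0,1)`. -/
lemma exists_subdivision {ι : Type*} [Inhabited ι] (s : Finset ι) (p : ι → ℝ)
    (hp : ∀ a ∈ s, 0 < p a) :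
    ∃ (c : ℝ → ι) (f : ℝ → ℝ), ∀ u ∈ Ico (0 : ℝ) (∑ a ∈ s, p a),
      c u ∈ s ∧ f u ∈ Ico (0 : ℝ) 1 ∧
      ∀ v ∈ Ico (0 : ℝ) (∑ a ∈ s, p a), c u = c v → u - v = p (c u) * (f u - f v) := by
  classical
  induction s using Finset.induction_on with
  | empty => exact ⟨fun _ => default, id, fun u hu => by simp at hu⟩
  | insert a s ha ih =>
    obtain ⟨c, f, h⟩ := ih fun b hb => hp b (Finset.mem_insert_of_mem hb)
    have hpa := hp a (Finset.mem_insert_self _ _)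
    rw [Finset.sum_insert ha]
    refine ⟨fun u => if u < p a then a else c (u - p a),
      fun u => if u < p a then u / p a else f (u - p a), fun u hu => ?_⟩
    have hshift : ∀ v ∈ Ico (0 : ℝ) (p a + ∑ b ∈ s, p b), ¬ v < p a →
        v - p a ∈ Ico (0 : ℝ) (∑ b ∈ s, p b) := fun v hv h1 =>
      ⟨by linarith, by linarith [hv.2]⟩
    by_cases h1 : u < p a
    · simp only [h1, if_true]
      refine ⟨Finset.mem_insert_self _ _, ⟨div_nonneg hu.1 hpa.le, (div_lt_one hpa).2 h1⟩,
        fun v hv e => ?_⟩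
      by_cases h2 : v < p a
      · simp only [h2, if_true]
        field_simp
      · simp only [h2, if_false] at e
        exact absurd (e ▸ (h _ (hshift v hv h2)).1) ha
    · simp only [h1, if_false]
      obtain ⟨m1, m2, m3⟩ := h _ (hshift u hu h1)
      refine ⟨Finset.mem_insert_of_mem m1, m2, fun v hv e => ?_⟩
      by_cases h2 : v < p a
      · simp only [h2, if_true] at e
        exact absurd (e ▸ m1) ha
      · simp only [h2, if_false] at e ⊢
        rw [← m3 _ (hshift v hv h2) e]
        ring

namespace GaussLikeIFS

variable {d : ℝ}

/-- A stage selecting one word out of a finite family of words of the same length. -/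
lemma exists_step_of_words (S : GaussLikeIFS d) {s : ℝ} (hs : 0 ≤ s) {p : ℕ+} {η rp : ℝ}
    (hη : 0 < η) (hp : ∀ x ∈ Icc (0 : ℝ) 1, η ≤ S.T p x ∧ S.T p x ≤ 1 - η)
    (hrp : S.Expands [p] rp) {q : ℕ} (W : Finset (List ℕ+)) (hW : W.Nonempty)
    (hWq : ∀ w ∈ W, w.length = q) (r : List ℕ+ → ℝ) (hr : ∀ w ∈ W, S.Expands w (r w)) :
    ∃ st : Step S s, st.len = q + 1 ∧ st.φ = (rp ^ s * ∑ w ∈ W, r w ^ s)⁻¹ := by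
  set G := ∑ w ∈ W, r w ^ s with hG
  have hpos : ∀ w ∈ W, 0 < r w ^ s := fun w hw => Real.rpow_pos_of_pos (hr w hw).1 _
  have hGpos : 0 < G := Finset.sum_pos hpos hW
  have hrps : 0 < rp ^ s := Real.rpow_pos_of_pos hrp.1 _
  obtain ⟨c, f, hcf⟩ := exists_subdivision W (fun w => r w ^ s / G)
    fun w hw => div_pos (hpos w hw) hGpos
  have hsum : ∑ w ∈ W, r w ^ s / G = 1 := by
    rw [← Finset.sum_div, ← hG, div_self hGpos.ne']
  rw [hsum] at hcf
  obtain ⟨w₀, hw₀, hmin⟩ := W.exists_min_image r hW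
  have hr0 := (hr w₀ hw₀).1
  have hδ : 0 < (η * r w₀) ^ s := Real.rpow_pos_of_pos (mul_pos hη hr0) _
  refine ⟨
    { len := q + 1
      φ := (rp ^ s * G)⁻¹
      κ := ((η * r w₀) ^ s)⁻¹
      φ_nonneg := by positivity
      word := fun u => c u ++ [p]
      next := f
      length_word := fun u hu => by simp [hWq _ (hcf u hu).1]
      next_mem := fun u hu => (hcf u hu).2.1
      same := fun u hu v hv e => ?_
      diff := fun u hu v hv e x hx y hy => ?_ }, rfl, rfl⟩
  · have e1 : c u = c v := List.append_cancel_right e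
    have hru := hr _ (hcf u hu).1
    refine ⟨r (c u) * rp, hru.append hrp, le_of_eq ?_⟩
    have h0 := hpos _ (hcf u hu).1
    rw [(hcf u hu).2.2 v hv e1, abs_mul, abs_of_pos (div_pos h0 hGpos),
      Real.mul_rpow hru.1.le hrp.1.le]
    field_simp
  · have e1 : c u ≠ c v := fun h => e (by rw [h])
    have hru := hr _ (hcf u hu).1
    have huv : |u - v| ≤ 1 :=
      abs_le.2 ⟨by linarith [hu.1, hv.2], by linarith [hu.2, hv.1]⟩
    refine huv.trans ?_
    rw [wordMap_append, wordMap_append]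
    have hz := hp x hx
    have hz' := hp y hy
    have h1 := hru.mul_le_abs_sub (z := S.T p x) (v := S.wordMap (c v) (S.T p y)) hη hz.1 hz.2
      fun t ht => S.wordMap_ne ((hWq _ (hcf u hu).1).trans (hWq _ (hcf v hv).1).symm) e1 ht
        ⟨by linarith, by linarith⟩
    have h2 : η * r w₀ ≤ |S.wordMap (c u) (S.T p x) - S.wordMap (c v) (S.T p y)| :=
      (mul_le_mul_of_nonneg_left (hmin _ (hcf u hu).1) hη.le).trans h1
    have h3 := Real.rpow_le_rpow (mul_pos hη hr0).le h2 hs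
    change 1 ≤ _ * |S.wordMap (c u) (S.T p x) - S.wordMap (c v) (S.T p y)| ^ s
    rw [← div_eq_inv_mul, le_div_iff₀ hδ, one_mul]
    exact h3

/-- Distance between the images of two maps of the system whose indices are far apart. -/
lemma mul_le_T_sub_T (S : GaussLikeIFS d) {i j : ℕ} {ℓ : ℝ} (hi : 0 < i)
    (hℓ : ∀ n : ℕ+, i < n → n ≤ j → S.Expands [n] ℓ) (hj : 0 < j + 1)
    (hij : i ≤ j) {x y : ℝ} (hx : x ∈ Icc (0 : ℝ) 1) (hy : y ∈ Icc (0 : ℝ) 1) :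
    ((j - i : ℕ) : ℝ) * ℓ ≤ S.T ⟨j + 1, hj⟩ y - S.T ⟨i, hi⟩ x := by
  have h0 : (0 : ℝ) ∈ Icc (0 : ℝ) 1 := by simp
  have h1 : (1 : ℝ) ∈ Icc (0 : ℝ) 1 := by simp
  induction j, hij using Nat.le_induction generalizing y with
  | base =>
    simp only [tsub_self, Nat.cast_zero, zero_mul, sub_nonneg]
    exact S.T_le_T (Subtype.mk_lt_mk.2 (Nat.lt_succ_self i)) hx hy
  | succ j hij ih =>
    have hj' : 0 < j + 1 := by omega
    have ih0 := ih (fun n hn hn' => hℓ n hn (by omega)) hj' h0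
    have ih1 := ih (fun n hn hn' => hℓ n hn (by omega)) hj' h1
    have hlt : (⟨j + 1, hj'⟩ : ℕ+) < ⟨j + 1 + 1, hj⟩ := Subtype.mk_lt_mk.2 (Nat.lt_succ_self _)
    have t0 := S.T_le_T hlt h0 hy
    have t1 := S.T_le_T hlt h1 hy
    have he : ℓ * |(1 : ℝ) - 0| ≤ |S.T ⟨j + 1, hj'⟩ 1 - S.T ⟨j + 1, hj'⟩ 0| :=
      (hℓ ⟨j + 1, hj'⟩ (Nat.lt_succ_of_le hij) le_rfl).2 1 h1 0 h0
    rw [sub_zero, abs_one, mul_one] at he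
    have hc : ((j + 1 - i : ℕ) : ℝ) = ((j - i : ℕ) : ℝ) + 1 := by
      rw [Nat.succ_sub hij]; push_cast; ring
    rw [hc]
    rcases abs_cases (S.T ⟨j + 1, hj'⟩ 1 - S.T ⟨j + 1, hj'⟩ 0) with ⟨e, -⟩ | ⟨e, -⟩ <;> nlinarith

/-- A stage selecting one of `N` digits of size comparable to `N`. -/
lemma exists_step_of_digits (S : GaussLikeIFS d) {s ε : ℝ} (hs : 0 < s) (hs1 : s ≤ 1)
    (hε : 0 < ε) :
    ∃ c : ℝ, 0 < c ∧ ∀ N : ℕ, 0 < N → ∃ st : Step S s, st.len = 1 ∧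
      st.φ ≤ c * (N : ℝ) ^ ((d + ε) * s - 1) ∧ st.κ ≤ c * (N : ℝ) ^ ((d + ε - 1) * s) ∧
      ∀ u ∈ Ico (0 : ℝ) 1, ∃ a : ℕ+, st.word u = [a] ∧ N ≤ (a : ℕ) := by
  obtain ⟨K, _, hK, -, hKb⟩ := S.exists_deriv_bounds hε
  have hdε : 0 < d + ε := by linarith [S.one_lt_d]
  have hℓ0 : 0 < K * (3 : ℝ) ^ (-(d + ε)) := by positivity
  refine ⟨2 * ((K * (3 : ℝ) ^ (-(d + ε))) ^ s)⁻¹, by positivity, fun N hN => ?_⟩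
  have hNR : (0 : ℝ) < N := by exact_mod_cast hN
  set ℓ : ℝ := K * ((3 * N : ℕ) : ℝ) ^ (-(d + ε)) with hℓ
  have hℓpos : 0 < ℓ := by
    have : (0 : ℝ) < ((3 * N : ℕ) : ℝ) := by exact_mod_cast (by omega : 0 < 3 * N)
    positivity
  have hℓeq : ℓ = K * (3 : ℝ) ^ (-(d + ε)) * (N : ℝ) ^ (-(d + ε)) := by
    rw [hℓ, Nat.cast_mul, Real.mul_rpow (by norm_num) hNR.le]
    push_cast
    ring
  have hℓs : ℓ ^ s = (K * (3 : ℝ) ^ (-(d + ε))) ^ s * ((N : ℝ) ^ ((d + ε) * s))⁻¹ := by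
    rw [hℓeq, Real.mul_rpow hℓ0.le (Real.rpow_nonneg hNR.le _), ← Real.rpow_mul hNR.le,
      ← Real.rpow_neg hNR.le]
    congr 2
    ring
  have hexp : ∀ n : ℕ+, (n : ℕ) ≤ 3 * N → S.Expands [n] ℓ := by
    intro n hn
    refine S.expands_singleton hℓpos fun x hx => le_trans ?_ (hKb n x hx).1
    have : (0 : ℝ) < ((n : ℕ) : ℝ) := by exact_mod_cast n.pos
    refine mul_le_mul_of_nonneg_left ?_ hK.le
    exact Real.rpow_le_rpow_of_nonpos this (by exact_mod_cast hn) (by linarith)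
  have hfl : ∀ u ∈ Ico (0 : ℝ) 1, ⌊(N : ℝ) * u⌋₊ < N := fun u hu => by
    rw [Nat.floor_lt (mul_nonneg hNR.le hu.1)]
    nlinarith [hu.2]
  have hdig : ∀ u : ℝ, 0 < N + 2 * ⌊(N : ℝ) * u⌋₊ := fun u => by omega
  have hsep : ∀ u ∈ Ico (0 : ℝ) 1, ∀ v ∈ Ico (0 : ℝ) 1,
      ⌊(N : ℝ) * u⌋₊ < ⌊(N : ℝ) * v⌋₊ → ∀ x ∈ Icc (0 : ℝ) 1, ∀ y ∈ Icc (0 : ℝ) 1,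
      |u - v| ≤ 2 * (((N : ℝ) * ℓ) ^ s)⁻¹ * |S.T ⟨_, hdig u⟩ x - S.T ⟨_, hdig v⟩ y| ^ s := by
    intro u hu v hv huv x hx y hy
    set a := ⌊(N : ℝ) * u⌋₊ with ha
    set b := ⌊(N : ℝ) * v⌋₊ with hb
    have hbN := hfl v hv
    rw [← hb] at hbN
    obtain ⟨m, hm⟩ : ∃ m, b = a + m + 1 := ⟨b - a - 1, by omega⟩
    have hdist := S.mul_le_T_sub_T (i := N + 2 * a) (j := N + 2 * b - 1) (ℓ := ℓ) (hdig u)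
      (fun n _ hn => hexp n (by omega)) (by omega) (by omega) hx hy
    have hjj : N + 2 * b - 1 + 1 = N + 2 * b := by omega
    simp only [hjj] at hdist
    have hcnt : N + 2 * b - 1 - (N + 2 * a) = 2 * m + 1 := by omega
    rw [hcnt] at hdist
    have hq : (0 : ℝ) < (m : ℝ) + 1 := by positivity
    have hd1 : ((m : ℝ) + 1) * ℓ ≤ |S.T ⟨_, hdig u⟩ x - S.T ⟨_, hdig v⟩ y| := by
      rw [abs_sub_comm]
      refine le_trans ?_ (le_abs_self _)
      refine le_trans ?_ hdist
      refine mul_le_mul_of_nonneg_right ?_ hℓpos.le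
      push_cast
      have : (0 : ℝ) ≤ m := by positivity
      linarith
    have hd2 := Real.rpow_le_rpow (by positivity) hd1 hs.le
    have a1 := Nat.floor_le (mul_nonneg hNR.le hu.1)
    have b1 := Nat.floor_le (mul_nonneg hNR.le hv.1)
    have b2 := Nat.lt_floor_add_one ((N : ℝ) * v)
    have a2 := Nat.lt_floor_add_one ((N : ℝ) * u)
    rw [← ha] at a1 a2
    rw [← hb, hm] at b1 b2
    push_cast at b1 b2
    have hle : |u - v| ≤ 2 * ((m : ℝ) + 1) / N := by
      rw [le_div_iff₀ hNR, show |u - v| * (N : ℝ) = |(u - v) * N| by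
        rw [abs_mul, abs_of_pos hNR], abs_le]
      have : (0 : ℝ) ≤ m := by positivity
      constructor <;> nlinarith
    have hmN : (m : ℝ) + 1 ≤ N := by
      have : m + 1 ≤ N := by omega
      exact_mod_cast this
    have hpow : ((m : ℝ) + 1) / N ≤ (((m : ℝ) + 1) / N) ^ s := by
      conv_lhs => rw [← Real.rpow_one (((m : ℝ) + 1) / N)]
      exact Real.rpow_le_rpow_of_exponent_ge (by positivity) ((div_le_one hNR).2 hmN) hs1
    have hprod : (((m : ℝ) + 1) / N) ^ s * ((N : ℝ) * ℓ) ^ s = (((m : ℝ) + 1) * ℓ) ^ s := by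
      rw [← Real.mul_rpow (by positivity) (by positivity)]
      congr 1
      field_simp
    have hNℓ : 0 < ((N : ℝ) * ℓ) ^ s := by positivity
    calc |u - v| ≤ 2 * (((m : ℝ) + 1) / N) := hle.trans (by rw [mul_div_assoc])
      _ ≤ 2 * (((m : ℝ) + 1) / N) ^ s := by linarith
      _ = 2 * (((N : ℝ) * ℓ) ^ s)⁻¹ * (((m : ℝ) + 1) * ℓ) ^ s := by
        rw [← hprod]; field_simp
      _ ≤ _ := mul_le_mul_of_nonneg_left hd2 (by positivity)
  have hL : 0 < (K * (3 : ℝ) ^ (-(d + ε))) ^ s := by positivity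
  refine ⟨
    { len := 1
      φ := (N * ℓ ^ s)⁻¹
      κ := 2 * (((N : ℝ) * ℓ) ^ s)⁻¹
      φ_nonneg := by positivity
      word := fun u => [⟨N + 2 * ⌊(N : ℝ) * u⌋₊, hdig u⟩]
      next := fun u => N * u - ⌊(N : ℝ) * u⌋₊
      length_word := fun u hu => rfl
      next_mem := fun u hu => ?_
      same := fun u hu v hv e => ⟨ℓ, hexp _ ?_, le_of_eq ?_⟩
      diff := fun u hu v hv e x hx y hy => ?_ }, rfl, ?_, ?_, fun u hu => ⟨_, rfl, ?_⟩⟩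
  · have h1 := Nat.floor_le (mul_nonneg hNR.le hu.1)
    have h2 := Nat.lt_floor_add_one ((N : ℝ) * u)
    exact ⟨by linarith, by linarith⟩
  · have := hfl u hu
    change N + 2 * ⌊(N : ℝ) * u⌋₊ ≤ 3 * N
    omega
  · have e1 : N + 2 * ⌊(N : ℝ) * u⌋₊ = N + 2 * ⌊(N : ℝ) * v⌋₊ :=
      congrArg PNat.val (List.singleton_injective e)
    have e2 : ⌊(N : ℝ) * u⌋₊ = ⌊(N : ℝ) * v⌋₊ := by omega
    rw [e2, sub_sub_sub_cancel_right, ← mul_sub, abs_mul, abs_of_pos hNR]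
    have : 0 < ℓ ^ s := by positivity
    field_simp
  · rcases lt_trichotomy ⌊(N : ℝ) * u⌋₊ ⌊(N : ℝ) * v⌋₊ with h | h | h
    · exact hsep u hu v hv h x hx y hy
    · exact absurd (by simp only [h]) e
    · rw [abs_sub_comm, abs_sub_comm (S.wordMap _ _)]
      exact hsep v hv u hu h y hy x hx
  · change ((N : ℝ) * ℓ ^ s)⁻¹ ≤ _
    rw [hℓs, Real.rpow_sub hNR, Real.rpow_one]
    have : 0 < (N : ℝ) ^ ((d + ε) * s) := by positivity
    have h2 : ((N : ℝ) * ((K * (3 : ℝ) ^ (-(d + ε))) ^ s * ((N : ℝ) ^ ((d + ε) * s))⁻¹))⁻¹ =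
        ((K * (3 : ℝ) ^ (-(d + ε))) ^ s)⁻¹ * ((N : ℝ) ^ ((d + ε) * s) / N) := by
      field_simp
    rw [h2]
    refine mul_le_mul_of_nonneg_right ?_ (by positivity)
    linarith [inv_pos.2 hL]
  · change 2 * (((N : ℝ) * ℓ) ^ s)⁻¹ ≤ _
    rw [Real.mul_rpow hNR.le hℓpos.le, hℓs, sub_mul, one_mul, Real.rpow_sub hNR]
    have h1 : 0 < (N : ℝ) ^ ((d + ε) * s) := by positivity
    have h2 : 0 < (N : ℝ) ^ s := by positivity
    refine le_of_eq ?_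
    field_simp
  · change N ≤ N + 2 * ⌊(N : ℝ) * u⌋₊
    omega

end GaussLikeIFS

namespace GaussLikeIFS

variable {d : ℝ}

lemma ceil_rpow_rpow_le {B β : ℝ} (hB : 1 < B) (hβ : 0 ≤ β) (e : ℝ) (n : ℕ) :
    (⌈B ^ (β * n)⌉₊ : ℝ) ^ e ≤ 2 ^ |e| * Real.exp (n * (Real.log B * (e * β))) := by
  have hB0 : 0 < B := by linarith
  have hX1 : 1 ≤ B ^ (β * n) := Real.one_le_rpow hB.le (by positivity)
  have hX : 0 < B ^ (β * n) := by linarith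
  have h1 := Nat.le_ceil (B ^ (β * n))
  have h2 := Nat.ceil_lt_add_one hX.le
  have hexp : (B ^ (β * n)) ^ e = Real.exp (n * (Real.log B * (e * β))) := by
    rw [← Real.rpow_mul hB0.le, Real.rpow_def_of_pos hB0]
    congr 1
    ring
  rw [← hexp]
  rcases le_total 0 e with he | he
  · rw [abs_of_nonneg he, ← Real.mul_rpow zero_le_two hX.le]
    exact Real.rpow_le_rpow (by positivity) (by linarith) he
  · calc _ ≤ (B ^ (β * n)) ^ e := Real.rpow_le_rpow_of_nonpos hX h1 he
      _ ≤ _ := le_mul_of_one_le_left (by positivity)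
        (Real.one_le_rpow one_le_two (abs_nonneg _))

/-- A stage prescribing the sizes of `I` consecutive digits, the `o`-th one being of
order `B ^ (β o * n)`. -/
lemma exists_step_of_exponents_aux (S : GaussLikeIFS d) {s ε B Λ : ℝ} (hs : 0 < s) (hs1 : s ≤ 1)
    (hε : 0 < ε) (hB : 1 < B) {β : ℕ → ℝ} (hβ : ∀ o, 0 ≤ β o) (I : ℕ)
    (hΛ : ∀ o < I, Real.log B * (((d + ε) * s - 1) * ∑ i ∈ Finset.range o, β i +
      (d + ε - 1) * s * β o) ≤ Λ) :
    ∃ c : ℝ, 0 < c ∧ ∀ n : ℕ, ∃ st : Step S s, st.len = I ∧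
      st.φ ≤ c * Real.exp (n * (Real.log B * (((d + ε) * s - 1) *
        ∑ i ∈ Finset.range I, β i))) ∧
      st.κ ≤ c * Real.exp (n * Λ) ∧
      ∀ u ∈ Ico (0 : ℝ) 1, ∀ o < I, ∃ a : ℕ+, (st.word u)[o]? = some a ∧
        B ^ (β o * n) ≤ ((a : ℕ) : ℝ) := by
  induction I with
  | zero =>
    refine ⟨1, one_pos, fun n => ⟨Step.nil S s, rfl, by simp [Step.nil], ?_, fun u hu o ho => ?_⟩⟩
    · change (0 : ℝ) ≤ _
      positivity
    · omega
  | succ I ih =>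
    obtain ⟨c, hc, hstep⟩ := ih fun o ho => hΛ o (by omega)
    obtain ⟨c', hc', hdig⟩ := S.exists_step_of_digits hs hs1 hε
    set e₁ := (d + ε) * s - 1 with he₁
    set e₂ := (d + ε - 1) * s with he₂
    refine ⟨c + c * (c' * 2 ^ |e₁|) + c * (c' * 2 ^ |e₂|), by positivity, fun n => ?_⟩
    obtain ⟨a, ha1, ha2, ha3, ha4⟩ := hstep n
    have hX : 0 < B ^ (β I * n) := by positivity
    obtain ⟨b, hb1, hb2, hb3, hb4⟩ := hdig ⌈B ^ (β I * n)⌉₊ (Nat.ceil_pos.2 hX)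
    have hbφ : b.φ ≤ c' * 2 ^ |e₁| * Real.exp (n * (Real.log B * (e₁ * β I))) := by
      rw [mul_assoc]
      exact hb2.trans (mul_le_mul_of_nonneg_left (ceil_rpow_rpow_le hB (hβ I) _ n) hc'.le)
    have hbκ : b.κ ≤ c' * 2 ^ |e₂| * Real.exp (n * (Real.log B * (e₂ * β I))) := by
      rw [mul_assoc]
      exact hb3.trans (mul_le_mul_of_nonneg_left (ceil_rpow_rpow_le hB (hβ I) _ n) hc'.le)
    have p1 : 0 < c * (c' * 2 ^ |e₁|) := by positivity
    have p2 : 0 < c * (c' * 2 ^ |e₂|) := by positivity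
    refine ⟨Step.comp hs.le a b, ?_, ?_, max_le ?_ ?_, fun u hu o ho => ?_⟩
    · change a.len + b.len = _
      rw [ha1, hb1]
    · change a.φ * b.φ ≤ _
      calc a.φ * b.φ ≤ _ := mul_le_mul ha2 hbφ b.φ_nonneg (by positivity)
        _ = c * (c' * 2 ^ |e₁|) * Real.exp (n * (Real.log B *
            (e₁ * ∑ i ∈ Finset.range (I + 1), β i))) := by
          rw [Finset.sum_range_succ, mul_add, mul_add, mul_add, Real.exp_add]
          ring
        _ ≤ _ := mul_le_mul_of_nonneg_right (by linarith) (Real.exp_nonneg _)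
    · exact ha3.trans (mul_le_mul_of_nonneg_right (by linarith) (Real.exp_nonneg _))
    · have hlast := hΛ I (Nat.lt_succ_self I)
      calc a.φ * b.κ ≤ a.φ * _ := mul_le_mul_of_nonneg_left hbκ a.φ_nonneg
        _ ≤ _ := mul_le_mul_of_nonneg_right ha2 (by positivity)
        _ = c * (c' * 2 ^ |e₂|) * Real.exp (n * (Real.log B *
            (e₁ * ∑ i ∈ Finset.range I, β i + e₂ * β I))) := by
          rw [mul_add, mul_add, Real.exp_add]
          ring
        _ ≤ c * (c' * 2 ^ |e₂|) * Real.exp (n * Λ) := by gcongr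
        _ ≤ _ := mul_le_mul_of_nonneg_right (by linarith) (Real.exp_nonneg _)
    · change ∃ x : ℕ+, (a.word u ++ b.word (a.next u))[o]? = some x ∧ _
      have hl := a.length_word u hu
      rw [ha1] at hl
      rcases Nat.lt_succ_iff_lt_or_eq.1 ho with h | rfl
      · rw [List.getElem?_append_left (by omega)]
        exact ha4 u hu o h
      · obtain ⟨x, hx1, hx2⟩ := hb4 _ (a.next_mem u hu)
        refine ⟨x, ?_, (Nat.le_ceil _).trans (by exact_mod_cast hx2)⟩
        rw [List.getElem?_append_right hl.le, hl, Nat.sub_self, hx1]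
        rfl

lemma exists_step_of_exponents (S : GaussLikeIFS d) {s B A Λ : ℝ} (hs : 0 < s) (hs1 : s ≤ 1)
    (hB : 1 < B) {β : ℕ → ℝ} (hβ : ∀ o, 0 ≤ β o) (I : ℕ)
    (hA : ∀ o < I, (d * s - 1) * ∑ i ∈ Finset.range o, β i + (d - 1) * s * β o ≤ A)
    (hA' : (d * s - 1) * ∑ i ∈ Finset.range I, β i ≤ A) (hΛ : A * Real.log B < Λ) :
    ∃ c : ℝ, 0 < c ∧ ∀ n : ℕ, ∃ st : Step S s, st.len = I ∧
      st.φ ≤ c * Real.exp (n * Λ) ∧ st.κ ≤ c * Real.exp (n * Λ) ∧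
      ∀ u ∈ Ico (0 : ℝ) 1, ∀ o < I, ∃ a : ℕ+, (st.word u)[o]? = some a ∧
        B ^ (β o * n) ≤ ((a : ℕ) : ℝ) := by
  have hlog := Real.log_pos hB
  set σ := ∑ i ∈ Finset.range I, β i with hσ
  have hσ0 : 0 ≤ σ := Finset.sum_nonneg fun i _ => hβ i
  set ε := (Λ - A * Real.log B) / (Real.log B * s * (σ + 1)) with hε
  have hD : 0 < Real.log B * s * (σ + 1) := by positivity
  have hεpos : 0 < ε := div_pos (by linarith) hD
  have hεeq : ε * (Real.log B * s * (σ + 1)) = Λ - A * Real.log B := div_mul_cancel₀ _ hD.ne'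
  have key : ∀ X Y : ℝ, X ≤ A → Y ≤ σ → Real.log B * (X + ε * s * Y) ≤ Λ := by
    intro X Y hX hY
    have h1 : Real.log B * X ≤ Real.log B * A := mul_le_mul_of_nonneg_left hX hlog.le
    have h2 : ε * s * Real.log B * Y ≤ ε * s * Real.log B * (σ + 1) :=
      mul_le_mul_of_nonneg_left (by linarith) (by positivity)
    nlinarith
  obtain ⟨c, hc, h⟩ := S.exists_step_of_exponents_aux (Λ := Λ) hs hs1 hεpos hB hβ I
    (fun o ho => by
      have h1 : ∑ i ∈ Finset.range (o + 1), β i ≤ σ :=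
        Finset.sum_le_sum_of_subset_of_nonneg
          (Finset.range_subset_range.2 (by omega)) fun i _ _ => hβ i
      rw [Finset.sum_range_succ] at h1
      refine le_trans (le_of_eq ?_) (key _ _ (hA o ho) h1)
      ring)
  refine ⟨c, hc, fun n => ?_⟩
  obtain ⟨st, h1, h2, h3, h4⟩ := h n
  refine ⟨st, h1, h2.trans ?_, h3, h4⟩
  have := key _ _ hA' le_rfl
  rw [← hσ]
  gcongr
  refine le_trans (le_of_eq ?_) this
  ring

lemma Step.exists_iterate {S : GaussLikeIFS d} {s : ℝ} (hs : 0 ≤ s) (st : Step S s)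
    (h1 : st.φ ≤ 1) (q : ℕ) :
    ∃ st' : Step S s, st'.len = q * st.len ∧ st'.φ = st.φ ^ q ∧ st'.κ ≤ max st.κ 0 := by
  induction q with
  | zero => exact ⟨Step.nil S s, by simp [Step.nil], by simp [Step.nil], le_max_right _ _⟩
  | succ q ih =>
    obtain ⟨a, h2, h3, h4⟩ := ih
    refine ⟨Step.comp hs st a, ?_, ?_, max_le (le_max_left _ _) ?_⟩
    · change st.len + a.len = _
      rw [h2]; ring
    · change st.φ * a.φ = _
      rw [h3]; ring
    · calc st.φ * a.κ ≤ st.φ * max st.κ 0 := mul_le_mul_of_nonneg_left h4 st.φ_nonneg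
        _ ≤ 1 * max st.κ 0 := mul_le_mul_of_nonneg_right h1 (le_max_right _ _)
        _ = _ := one_mul _

/-- The parameter of a stage with small mass is at most the dimension of the line. -/
lemma Step.le_one {S : GaussLikeIFS d} {s : ℝ} (hs : 0 < s) (st : Step S s) (hlen : 0 < st.len)
    (h1 : st.φ < 1) : s ≤ 1 := by
  have h := Step.ofReal_le_dimH (fun _ => st) hs (C := max st.κ 0) (A := univ)
    (le_max_right _ _) (fun _ => hlen) (fun l => ?_) ?_ (fun _ _ _ _ _ _ _ => mem_univ _)
  · rw [Real.dimH_univ] at h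
    simpa using h
  · simp only [Finset.prod_const, Finset.card_range]
    calc _ ≤ st.φ ^ l * max st.κ 0 :=
          mul_le_mul_of_nonneg_left (le_max_left _ _) (pow_nonneg st.φ_nonneg _)
      _ ≤ 1 * max st.κ 0 := mul_le_mul_of_nonneg_right
          (pow_le_one₀ st.φ_nonneg h1.le) (le_max_right _ _)
      _ = _ := one_mul _
  · simp only [Finset.prod_const, Finset.card_range]
    exact tendsto_pow_atTop_nhds_zero_of_lt_one st.φ_nonneg h1

/-- Many repetitions of a cheap stage followed by a stage with prescribed digit sizes. -/
lemma exists_round (S : GaussLikeIFS d) {s B A : ℝ} (hs : 0 < s) (hs1 : s ≤ 1)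
    (hB : 1 < B) {β : ℕ → ℝ} (hβ : ∀ o, 0 ≤ β o) (I : ℕ)
    (hA : ∀ o < I, (d * s - 1) * ∑ i ∈ Finset.range o, β i + (d - 1) * s * β o ≤ A)
    (hA' : (d * s - 1) * ∑ i ∈ Finset.range I, β i ≤ A) (hA0 : 0 ≤ A) (st : Step S s)
    (hφ0 : 0 < st.φ) (hlen : 0 < st.len) (hφ : st.len * (A * Real.log B) < -Real.log st.φ)
    (p : ℕ) :
    ∃ (st' : Step S s) (q : ℕ), 0 < st'.len ∧ st'.φ ≤ 1 / 2 ∧ st'.κ ≤ max st.κ 1 ∧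
      ∀ u ∈ Ico (0 : ℝ) 1, ∀ o < I, ∃ a : ℕ+, q + o < st'.len ∧
        (st'.word u)[q + o]? = some a ∧ B ^ (β o * ((p + q : ℕ) : ℝ)) ≤ ((a : ℕ) : ℝ) := by
  have hlog := Real.log_pos hB
  have hlenR : (0 : ℝ) < st.len := by exact_mod_cast hlen
  obtain ⟨Λ, hΛ1, hΛ2⟩ : ∃ Λ, A * Real.log B < Λ ∧ Λ < -Real.log st.φ / st.len :=
    exists_between ((lt_div_iff₀' hlenR).2 hφ)
  have hΛ0 : 0 < Λ := (mul_nonneg hA0 hlog.le).trans_lt hΛ1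
  rw [lt_div_iff₀' hlenR] at hΛ2
  have hφ1 : st.φ < 1 := by
    have : Real.log st.φ < 0 := by nlinarith
    exact (Real.log_neg_iff hφ0).1 this
  obtain ⟨c, hc, hins⟩ := S.exists_step_of_exponents hs hs1 hB hβ I hA hA' hΛ1
  set ρ := st.φ * Real.exp (st.len * Λ) with hρ
  have hρ0 : 0 ≤ ρ := by positivity
  have hρ1 : ρ < 1 := by
    rw [hρ, ← Real.exp_log hφ0, ← Real.exp_add]
    exact (Real.exp_lt_exp.2 (by linarith)).trans_eq Real.exp_zero
  have hlim : Tendsto (fun q : ℕ => ρ ^ q * (c * Real.exp (p * Λ))) atTop (𝓝 0) := by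
    have := (tendsto_pow_atTop_nhds_zero_of_lt_one hρ0 hρ1).mul_const (c * Real.exp (p * Λ))
    rwa [zero_mul] at this
  obtain ⟨q, hq1, hq⟩ := ((eventually_ge_atTop 1).and
    (hlim.eventually (gt_mem_nhds (by norm_num : (0 : ℝ) < 1 / 2)))).exists
  obtain ⟨a, ha1, ha2, ha3⟩ := st.exists_iterate hs.le hφ1.le q
  obtain ⟨b, hb1, hb2, hb3, hb4⟩ := hins (p + q * st.len)
  have hbd : a.φ * (c * Real.exp (((p + q * st.len : ℕ) : ℝ) * Λ)) ≤ 1 / 2 := by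
    refine le_trans (le_of_eq ?_) hq.le
    rw [ha2, hρ, mul_pow, ← Real.exp_nat_mul]
    push_cast
    rw [add_mul, Real.exp_add]
    ring_nf
  have hpos : 0 < q * st.len := Nat.mul_pos hq1 hlen
  refine ⟨Step.comp hs.le a b, q * st.len, ?_, ?_, max_le ?_ ?_, fun u hu o ho => ?_⟩
  · change 0 < a.len + b.len
    omega
  · exact (mul_le_mul_of_nonneg_left hb2 a.φ_nonneg).trans hbd
  · exact ha3.trans (max_le_max le_rfl zero_le_one)
  · calc a.φ * b.κ ≤ _ := mul_le_mul_of_nonneg_left hb3 a.φ_nonneg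
      _ ≤ 1 / 2 := hbd
      _ ≤ 1 := by norm_num
      _ ≤ _ := le_max_right _ _
  · obtain ⟨x, hx1, hx2⟩ := hb4 _ (a.next_mem u hu) o ho
    refine ⟨x, ?_, ?_, hx2⟩
    · change _ < a.len + b.len
      omega
    · change (a.word u ++ b.word (a.next u))[q * st.len + o]? = some x
      have hl := a.length_word u hu
      rw [List.getElem?_append_right (by omega), ← hx1]
      congr 1
      omega

lemma ofReal_le_dimH_Eset_of_exponents (S : GaussLikeIFS d) {s B A : ℝ} (hs : 0 < s)
    (hB : 1 < B) {β : ℕ → ℝ} (hβ : ∀ o, 0 ≤ β o) (I : ℕ)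
    (hA : ∀ o < I, (d * s - 1) * ∑ i ∈ Finset.range o, β i + (d - 1) * s * β o ≤ A)
    (hA' : (d * s - 1) * ∑ i ∈ Finset.range I, β i ≤ A) (hA0 : 0 ≤ A) (st : Step S s)
    (hφ0 : 0 < st.φ) (hlen : 0 < st.len) (hφ : st.len * (A * Real.log B) < -Real.log st.φ)
    {k : ℕ} {i : Fin k → ℕ} (hi : ∀ m, i m < I) {t : Fin k → ℝ} (ht : ∀ m, 0 < t m)
    (hβt : ∑ m, β (i m) * t m = 1) :
    ENNReal.ofReal s ≤ dimH (S.Eset B i t) := by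
  have hlog := Real.log_pos hB
  have hφ1 : st.φ < 1 := by
    have h0 : 0 ≤ st.len * (A * Real.log B) := by positivity
    exact (Real.log_neg_iff hφ0).1 (by linarith)
  have hs1 := st.le_one hs hlen hφ1
  choose f q hf1 hf2 hf3 hf4 using
    S.exists_round hs hs1 hB hβ I hA hA' hA0 st hφ0 hlen hφ
  let pos : ℕ → ℕ := fun l => Nat.rec 0 (fun _ p => p + (f p).len) l
  have hpos : ∀ l, ∑ j ∈ Finset.range l, (f (pos j)).len = pos l := by
    intro l
    induction l with
    | zero => rfl
    | succ l ih => rw [Finset.sum_range_succ, ih]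
  have hposl : ∀ l, l ≤ pos l := by
    intro l
    induction l with
    | zero => exact Nat.zero_le _
    | succ l ih =>
      change l + 1 ≤ pos l + (f (pos l)).len
      have := hf1 (pos l)
      omega
  have hprod0 : ∀ l, 0 ≤ ∏ j ∈ Finset.range l, (f (pos j)).φ := fun l =>
    Finset.prod_nonneg fun j _ => (f (pos j)).φ_nonneg
  have hprod : ∀ l, ∏ j ∈ Finset.range l, (f (pos j)).φ ≤ (1 / 2) ^ l := by
    intro l
    calc _ ≤ ∏ j ∈ Finset.range l, (1 / 2 : ℝ) :=
          Finset.prod_le_prod (fun j _ => (f (pos j)).φ_nonneg) fun j _ => hf2 _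
      _ = _ := by simp
  have hC1 : (0 : ℝ) ≤ max st.κ 1 := zero_le_one.trans (le_max_right _ _)
  refine Step.ofReal_le_dimH (fun l => f (pos l)) hs hC1 (fun l => hf1 _) (fun l => ?_) ?_ ?_
  · calc _ ≤ (∏ j ∈ Finset.range l, (f (pos j)).φ) * max st.κ 1 :=
          mul_le_mul_of_nonneg_left (hf3 _) (hprod0 l)
      _ ≤ 1 * max st.κ 1 := mul_le_mul_of_nonneg_right
          ((hprod l).trans (pow_le_one₀ (by norm_num) (by norm_num))) hC1
      _ = _ := one_mul _
  · exact squeeze_zero hprod0 hprod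
      (tendsto_pow_atTop_nhds_zero_of_lt_one (by norm_num) (by norm_num))
  · intro u hu a x hx hcyl hword
    refine ⟨hx, a, hcyl, frequently_atTop.2 fun N => ⟨pos N + q (pos N), ?_, ?_⟩⟩
    · have := hposl N
      omega
    set n := pos N + q (pos N) with hn
    have hdig : ∀ m, B ^ (β (i m) * (n : ℝ)) ≤ ((a (n + i m) : ℕ) : ℝ) := by
      intro m
      obtain ⟨c, hc1, hc2, hc3⟩ := hf4 (pos N) (u N) (hu N) (i m) (hi m)
      have h := hword N (q (pos N) + i m) hc1
      rw [hpos, hc2, ← add_assoc] at h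
      rwa [← Option.some_injective _ h]
    have hB0 : 0 < B := by linarith
    calc B ^ n = ∏ m, (B ^ (β (i m) * (n : ℝ))) ^ t m := by
          simp_rw [← Real.rpow_mul hB0.le]
          rw [← Real.rpow_sum_of_pos hB0, ← Real.rpow_natCast]
          congr 1
          calc (n : ℝ) = n * ∑ m, β (i m) * t m := by rw [hβt, mul_one]
            _ = _ := by rw [Finset.mul_sum]; exact Finset.sum_congr rfl fun m _ => by ring
      _ ≤ _ := Finset.prod_le_prod (fun m _ => by positivity) fun m _ =>
          Real.rpow_le_rpow (by positivity) (hdig m) (ht m).le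

lemma mul_sum_le_of_Am_le {s A : ℝ} (hs1 : s ≤ 1) (hA0 : 0 ≤ A) {k : ℕ}
    {b : Fin k → ℝ} (hb : ∀ m, 0 ≤ b m) (hA : ∀ m, Am d b s m ≤ A) (F : Finset (Fin k)) :
    (d * s - 1) * ∑ m ∈ F, b m ≤ A := by
  have hF : 0 ≤ ∑ m ∈ F, b m := Finset.sum_nonneg fun m _ => hb m
  rcases le_total (d * s - 1) 0 with h | h
  · exact (mul_nonpos_of_nonpos_of_nonneg h hF).trans hA0
  · rcases F.eq_empty_or_nonempty with rfl | hne
    · simpa using hA0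
    · set j := F.max' hne
      have hsub : F ⊆ Finset.Iic j := fun m hm => Finset.mem_Iic.2 (F.le_max' m hm)
      have h1 : ∑ m ∈ F, b m ≤ ∑ m ∈ Finset.Iic j, b m :=
        Finset.sum_le_sum_of_subset_of_nonneg hsub fun m _ _ => hb m
      have h2 : ∑ m ∈ Finset.Iic j, b m = b j + ∑ m ∈ Finset.Iio j, b m := by
        rw [← Finset.Iio_insert, Finset.sum_insert (by simp)]
      have h3 := hA j
      unfold Am at h3
      have h4 : (d * s - 1) * ∑ m ∈ F, b m ≤ (d * s - 1) * ∑ m ∈ Finset.Iic j, b m :=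
        mul_le_mul_of_nonneg_left h1 h
      rw [h2, mul_add] at h4
      have h5 : (d * s - 1) * b j ≤ (d - 1) * s * b j :=
        mul_le_mul_of_nonneg_right (by nlinarith) (hb j)
      linarith

/-- Lower bound for the dimension of `Eset` from a cheap stage. -/
lemma ofReal_le_dimH_Eset (S : GaussLikeIFS d) {s B A : ℝ} (hs : 0 < s) (hB : 1 < B)
    {k : ℕ} {i : Fin k → ℕ} (hi : StrictMono i) {t : Fin k → ℝ} (ht : ∀ m, 0 < t m)
    {b : Fin k → ℝ} (hb : b ∈ simplexS t) (hA0 : 0 ≤ A) (hA : ∀ m, Am d b s m ≤ A)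
    (st : Step S s) (hφ0 : 0 < st.φ) (hlen : 0 < st.len)
    (hφ : st.len * (A * Real.log B) < -Real.log st.φ) :
    ENNReal.ofReal s ≤ dimH (S.Eset B i t) := by
  have hlog := Real.log_pos hB
  have hφ1 : st.φ < 1 := by
    have h0 : 0 ≤ st.len * (A * Real.log B) := by positivity
    exact (Real.log_neg_iff hφ0).1 (by linarith)
  have hs1 := st.le_one hs hlen hφ1
  let β : ℕ → ℝ := fun o => ∑ m, if i m = o then b m else 0
  have hβ : ∀ o, 0 ≤ β o := fun o => Finset.sum_nonneg fun m _ => by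
    split_ifs
    · exact hb.1 m
    · exact le_rfl
  have hβi : ∀ m, β (i m) = b m := fun m => by
    change ∑ m', (if i m' = i m then b m' else 0) = b m
    simp [hi.injective.eq_iff]
  have hβsum : ∀ o, ∑ j ∈ Finset.range o, β j = ∑ m with i m < o, b m := by
    intro o
    change ∑ j ∈ Finset.range o, ∑ m, (if i m = j then b m else 0) = _
    rw [Finset.sum_comm, Finset.sum_filter]
    refine Finset.sum_congr rfl fun m _ => ?_
    rw [Finset.sum_ite_eq]
    simp
  have hF := mul_sum_le_of_Am_le hs1 hA0 hb.1 hA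
  refine S.ofReal_le_dimH_Eset_of_exponents hs hB hβ (∑ m, (i m + 1)) (fun o _ => ?_)
    (by rw [hβsum]; exact hF _) hA0 st hφ0 hlen hφ (fun m => ?_) ht
    (by simp_rw [hβi]; exact hb.2)
  · rw [hβsum]
    by_cases ho : ∃ m, i m = o
    · obtain ⟨m, rfl⟩ := ho
      rw [hβi]
      have h1 := hA m
      unfold Am at h1
      have h2 : (Finset.univ.filter fun m' => i m' < i m) = Finset.Iio m := by
        ext m'
        simp [hi.lt_iff_lt]
      rw [h2]
      linarith
    · have : β o = 0 := Finset.sum_eq_zero fun m _ => if_neg fun h => ho ⟨m, h⟩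
      rw [this, mul_zero, add_zero]
      exact hF _
  · exact Nat.lt_of_succ_le (Finset.single_le_sum (f := fun m => i m + 1)
      (fun m _ => Nat.zero_le _) (Finset.mem_univ m))

end GaussLikeIFS

namespace GaussLikeIFS

variable {d : ℝ}

/-- Below `1 / d` single digits already form arbitrarily cheap stages. -/
lemma ofReal_le_dimH_Eset_of_lt (S : GaussLikeIFS d) {s B : ℝ} (hs : 0 < s) (hsd : s < 1 / d)
    (hB : 1 < B) {k : ℕ} {i : Fin k → ℕ} (hi : StrictMono i) {t : Fin k → ℝ}
    (ht : ∀ m, 0 < t m) {b : Fin k → ℝ} (hb : b ∈ simplexS t) :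
    ENNReal.ofReal s ≤ dimH (S.Eset B i t) := by
  have hd := S.one_lt_d
  have hε : 0 < 1 / s - d := by
    rw [lt_div_iff₀ (by linarith)] at hsd
    rw [sub_pos, lt_div_iff₀ hs]
    linarith
  obtain ⟨K₁, K₂, hK₁, -, hK⟩ := S.exists_deriv_bounds hε
  obtain ⟨p, η, hη, hp⟩ := S.exists_interior_digit
  obtain ⟨rp, hrp⟩ := S.exists_expands_singleton p
  set A := ∑ m, |Am d b s m| with hA
  have hrps : 0 < rp ^ s := Real.rpow_pos_of_pos hrp.1 _
  have hKs : 0 < K₁ ^ s := Real.rpow_pos_of_pos hK₁ _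
  obtain ⟨N, hN⟩ := (Real.tendsto_sum_range_one_div_nat_succ_atTop.eventually_gt_atTop
    (Real.exp (2 * (A * Real.log B)) / (rp ^ s * K₁ ^ s))).exists
  let r : List ℕ+ → ℝ := fun w => K₁ * ((w.headI : ℕ) : ℝ) ^ (-(d + (1 / s - d)))
  let W : Finset (List ℕ+) := (Finset.range N).image fun j => [j.succPNat]
  have hsum : ∑ w ∈ W, r w ^ s = K₁ ^ s * ∑ j ∈ Finset.range N, 1 / ((j : ℝ) + 1) := by
    rw [Finset.sum_image fun a _ a' _ h => by simpa using h, Finset.mul_sum]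
    refine Finset.sum_congr rfl fun j _ => ?_
    have h1 : (0 : ℝ) ≤ ((j.succPNat : ℕ) : ℝ) := Nat.cast_nonneg _
    have h2 : -(d + (1 / s - d)) * s = -1 := by
      field_simp
      ring
    change (K₁ * ((j.succPNat : ℕ) : ℝ) ^ (-(d + (1 / s - d)))) ^ s = _
    rw [Real.mul_rpow hK₁.le (Real.rpow_nonneg h1 _), ← Real.rpow_mul h1, h2, Real.rpow_neg_one,
      Nat.succPNat_coe, Nat.cast_succ, one_div]
  have hW : W.Nonempty := by
    refine Finset.Nonempty.image (Finset.nonempty_range_iff.2 ?_) _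
    rintro rfl
    have : 0 < Real.exp (2 * (A * Real.log B)) / (rp ^ s * K₁ ^ s) := by positivity
    simp only [Finset.range_zero, Finset.sum_empty] at hN
    linarith
  obtain ⟨st, hlen, hφ⟩ := S.exists_step_of_words hs.le hη hp hrp (q := 1) W hW
    (fun w hw => by
      obtain ⟨j, -, rfl⟩ := Finset.mem_image.1 hw
      rfl) r
    (fun w hw => by
      obtain ⟨j, -, rfl⟩ := Finset.mem_image.1 hw
      have h1 : (0 : ℝ) < ((j.succPNat : ℕ) : ℝ) := Nat.cast_pos.2 j.succPNat.pos
      exact S.expands_singleton (mul_pos hK₁ (Real.rpow_pos_of_pos h1 _)) fun x hx =>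
        (hK j.succPNat x hx).1)
  rw [div_lt_iff₀ (by positivity)] at hN
  have hlt : Real.exp (2 * (A * Real.log B)) < rp ^ s * ∑ w ∈ W, r w ^ s := by
    rw [hsum]
    linarith
  have hpos := (Real.exp_pos _).trans hlt
  refine S.ofReal_le_dimH_Eset hs hB hi ht hb (Finset.sum_nonneg fun m _ => abs_nonneg _)
    (fun m => (le_abs_self _).trans
      (Finset.single_le_sum (f := fun m => |Am d b s m|) (fun _ _ => abs_nonneg _)
        (Finset.mem_univ m))) st (by rw [hφ]; exact inv_pos.2 hpos) (by omega) ?_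
  rw [hφ, hlen, Real.log_inv, neg_neg, Real.lt_log_iff_exp_lt hpos]
  norm_num
  exact hlt

lemma hasDerivWithinAt_wordMap (S : GaussLikeIFS d) (w : List ℕ+) {x : ℝ}
    (hx : x ∈ Icc (0 : ℝ) 1) :
    (w.foldr (fun i p => (S.T i p.1, S.T' i p.1 * p.2)) (x, (1 : ℝ))).1 = S.wordMap w x ∧
    HasDerivWithinAt (S.wordMap w)
      (w.foldr (fun i p => (S.T i p.1, S.T' i p.1 * p.2)) (x, (1 : ℝ))).2 (Icc 0 1) x := by
  induction w with
  | nil => exact ⟨rfl, hasDerivWithinAt_id _ _⟩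
  | cons i w ih =>
    refine ⟨by rw [List.foldr_cons, wordMap_cons, ← ih.1], ?_⟩
    simp only [List.foldr_cons, ih.1]
    exact (S.hasDeriv i _ (S.wordMap_mem w hx)).comp x ih.2 fun y hy => S.wordMap_mem w hy

/-- Long words contract the unit interval uniformly. -/
lemma exists_length_abs_sub_le (S : GaussLikeIFS d) {ρ : ℝ} (hρ : 0 < ρ) :
    ∃ n : ℕ, ∀ w : List ℕ+, n ≤ w.length → ∀ x ∈ Icc (0 : ℝ) 1, ∀ y ∈ Icc (0 : ℝ) 1,
      |S.wordMap w x - S.wordMap w y| ≤ ρ := by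
  obtain ⟨m, h, -, h0, h1, hc⟩ := S.contracting
  have hm : ∀ w : List ℕ+, w.length = m → ∀ x ∈ Icc (0 : ℝ) 1, ∀ y ∈ Icc (0 : ℝ) 1,
      |S.wordMap w x - S.wordMap w y| ≤ h * |x - y| := by
    rintro w rfl x hx y hy
    refine (convex_Icc (0 : ℝ) 1).norm_image_sub_le_of_norm_hasDerivWithin_le
      (fun z hz => (S.hasDerivWithinAt_wordMap w hz).2) (fun z hz => ?_) hy hx
    have := (hc w.get z hz).2
    rwa [chainDeriv, List.ofFn_get] at this
  have hq : ∀ (q : ℕ) (w : List ℕ+), q * m ≤ w.length → ∀ x ∈ Icc (0 : ℝ) 1,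
      ∀ y ∈ Icc (0 : ℝ) 1, |S.wordMap w x - S.wordMap w y| ≤ h ^ q := by
    intro q
    induction q with
    | zero =>
      intro w _ x hx y hy
      have hx' := S.wordMap_mem w hx
      have hy' := S.wordMap_mem w hy
      rw [pow_zero]
      exact abs_le.2 ⟨by linarith [hx'.1, hy'.2], by linarith [hx'.2, hy'.1]⟩
    | succ q ih =>
      intro w hw x hx y hy
      rw [add_mul, one_mul] at hw
      rw [← List.take_append_drop m w, wordMap_append, wordMap_append, pow_succ']
      refine (hm _ (by rw [List.length_take]; omega) _ (S.wordMap_mem _ hx) _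
        (S.wordMap_mem _ hy)).trans ?_
      exact mul_le_mul_of_nonneg_left (ih _ (by rw [List.length_drop]; omega) x hx y hy) h0.le
  obtain ⟨q, hlt⟩ := exists_pow_lt_of_lt_one hρ h1
  exact ⟨q * m, fun w hw x hx y hy => (hq q w hw x hx y hy).trans hlt.le⟩

lemma T'_ne_zero (S : GaussLikeIFS d) (i : ℕ+) {x : ℝ} (hx : x ∈ Icc (0 : ℝ) 1) :
    S.T' i x ≠ 0 := by
  obtain ⟨K₁, K₂, h1, -, h⟩ := S.exists_deriv_bounds one_pos
  have : (0 : ℝ) < ((i : ℕ) : ℝ) := by exact_mod_cast i.pos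
  exact abs_pos.1 ((by positivity : (0 : ℝ) < _).trans_le (h i x hx).1)

lemma exists_abs_T'_le (S : GaussLikeIFS d) :
    ∃ K : ℝ, 1 ≤ K ∧ ∀ i : ℕ+, ∀ x ∈ Icc (0 : ℝ) 1, |S.T' i x| ≤ K := by
  obtain ⟨K₁, K₂, -, -, h⟩ := S.exists_deriv_bounds (one_pos.trans S.one_lt_d)
  refine ⟨max K₂ 1, le_max_right _ _, fun i x hx => ?_⟩
  have := (h i x hx).2
  rw [sub_self, neg_zero, Real.rpow_zero, mul_one] at this
  exact this.trans (le_max_left _ _)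

/-- Oscillation of a single derivative at small scales. -/
lemma eventually_exp_mul_le (S : GaussLikeIFS d) (i : ℕ+) {η : ℝ} (hη : 0 < η) :
    ∀ᶠ ρ in 𝓝[>] (0 : ℝ), ∀ x ∈ Icc (0 : ℝ) 1, ∀ y ∈ Icc (0 : ℝ) 1, |x - y| ≤ ρ →
      Real.exp (-η) * |S.T' i y| ≤ |S.T' i x| := by
  have hc : ContinuousOn (fun x => Real.log |S.T' i x|) (Icc 0 1) :=
    (S.derivCont i).abs.log fun x hx => abs_ne_zero.2 (S.T'_ne_zero i hx)
  obtain ⟨δ, hδ, h⟩ := Metric.uniformContinuousOn_iff.1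
    (isCompact_Icc.uniformContinuousOn_of_continuous hc) η hη
  filter_upwards [Ioo_mem_nhdsGT hδ] with ρ hρ x hx y hy hxy
  have h1 := (abs_lt.1 (h x hx y hy (by rw [Real.dist_eq]; linarith [hρ.2]))).1
  have px := abs_pos.2 (S.T'_ne_zero i hx)
  have py := abs_pos.2 (S.T'_ne_zero i hy)
  rw [← Real.exp_log py, ← Real.exp_add, ← Real.le_log_iff_exp_le px]
  linarith

/-- Distortion bounds, uniform in the digit. -/
lemma exists_distortion (S : GaussLikeIFS d) {δ η K : ℝ} (hδ : 0 < δ) (hη : 0 < η) (hK1 : 1 ≤ K)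
    (hK : ∀ i : ℕ+, ∀ x ∈ Icc (0 : ℝ) 1, |S.T' i x| ≤ K) :
    ∃ c ρ : ℝ, 0 < c ∧ c ≤ 1 ∧ 0 < ρ ∧ ∀ i : ℕ+, ∀ x ∈ Icc (0 : ℝ) 1, ∀ y ∈ Icc (0 : ℝ) 1,
      c * |S.T' i y| ^ (1 + δ) ≤ |S.T' i x| ∧
      (|x - y| ≤ ρ → Real.exp (-η) * K ^ (-δ) * |S.T' i y| ^ (1 + δ) ≤ |S.T' i x|) := by
  have hd := S.one_lt_d
  have hK0 : 0 < K := by linarith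
  set ε := d * δ / (3 + δ) with hε
  have hεpos : 0 < ε := by positivity
  obtain ⟨K₁, K₂, h1, h2, h⟩ := S.exists_deriv_bounds hεpos
  have hexp : -(d - ε) * (1 + δ) = -(d + ε) - ε := by
    rw [hε]
    field_simp
    ring
  set c := K₁ / K₂ ^ (1 + δ) with hc
  have hK₂ : 0 < K₂ ^ (1 + δ) := Real.rpow_pos_of_pos h2 _
  have hc0 : 0 < c := div_pos h1 hK₂
  have main : ∀ i : ℕ+, ∀ x ∈ Icc (0 : ℝ) 1, ∀ y ∈ Icc (0 : ℝ) 1,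
      c * ((i : ℕ) : ℝ) ^ ε * |S.T' i y| ^ (1 + δ) ≤ |S.T' i x| := by
    intro i x hx y hy
    have hi : (0 : ℝ) < ((i : ℕ) : ℝ) := by exact_mod_cast i.pos
    calc _ ≤ c * ((i : ℕ) : ℝ) ^ ε * (K₂ * ((i : ℕ) : ℝ) ^ (-(d - ε))) ^ (1 + δ) := by
          gcongr
          exact (h i y hy).2
      _ = K₁ * ((i : ℕ) : ℝ) ^ (-(d + ε)) := by
          rw [Real.mul_rpow h2.le (by positivity), ← Real.rpow_mul hi.le, hexp, Real.rpow_sub hi,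
            hc]
          have := Real.rpow_pos_of_pos hi ε
          field_simp
      _ ≤ _ := (h i x hx).1
  have hlim : Tendsto (fun n : ℕ => c * (n : ℝ) ^ ε) atTop atTop :=
    ((tendsto_rpow_atTop hεpos).comp tendsto_natCast_atTop_atTop).const_mul_atTop hc0
  obtain ⟨N, hN⟩ := eventually_atTop.1 (hlim.eventually_ge_atTop 1)
  have hfin : {i : ℕ+ | (i : ℕ) < N}.Finite :=
    (Set.finite_lt_nat N).preimage PNat.coe_injective.injOn
  obtain ⟨ρ, hρ, hρ0⟩ := (((eventually_all_finite hfin).2 fun i _ =>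
    S.eventually_exp_mul_le i hη).and self_mem_nhdsWithin).exists
  refine ⟨min c 1, ρ, lt_min hc0 one_pos, min_le_right _ _, hρ0, fun i x hx y hy =>
    ⟨(mul_le_mul_of_nonneg_right ?_ (by positivity)).trans (main i x hx y hy), fun hxy => ?_⟩⟩
  · refine (min_le_left _ _).trans (le_mul_of_one_le_right hc0.le (Real.one_le_rpow ?_ hεpos.le))
    exact_mod_cast i.pos
  · rcases lt_or_ge (i : ℕ) N with hi | hi
    · refine le_trans ?_ (hρ i hi x hx y hy hxy)
      have py := abs_pos.2 (S.T'_ne_zero i hy)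
      have h3 : |S.T' i y| ^ δ ≤ K ^ δ := Real.rpow_le_rpow py.le (hK i y hy) hδ.le
      have h4 : K ^ (-δ) * |S.T' i y| ^ δ ≤ 1 := by
        rw [Real.rpow_neg hK0.le, inv_mul_le_iff₀ (by positivity), mul_one]
        exact h3
      rw [Real.rpow_add py, Real.rpow_one]
      calc _ = Real.exp (-η) * |S.T' i y| * (K ^ (-δ) * |S.T' i y| ^ δ) := by ring
        _ ≤ Real.exp (-η) * |S.T' i y| * 1 := by gcongr
        _ = _ := mul_one _
    · refine (mul_le_mul_of_nonneg_right ?_ (by positivity)).trans (main i x hx y hy)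
      refine le_trans ?_ (hN _ hi)
      exact mul_le_one₀ (Real.exp_le_one_iff.2 (by linarith)) (by positivity)
        (Real.rpow_le_one_of_one_le_of_nonpos hK1 (by linarith))

lemma wordMap_mem_uIcc (S : GaussLikeIFS d) (w : List ℕ+) {x : ℝ} (hx : x ∈ Icc (0 : ℝ) 1) :
    S.wordMap w x ∈ uIcc (S.wordMap w 0) (S.wordMap w 1) := by
  have h0 : (0 : ℝ) ∈ Icc (0 : ℝ) 1 := by simp
  have h1 : (1 : ℝ) ∈ Icc (0 : ℝ) 1 := by simp
  rcases S.strictMonoOn_or_strictAntiOn w with h | h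
  · exact Icc_subset_uIcc ⟨h.monotoneOn h0 hx hx.1, h.monotoneOn hx h1 hx.2⟩
  · exact Icc_subset_uIcc' ⟨h.antitoneOn hx h1 hx.2, h.antitoneOn h0 hx hx.1⟩

lemma diam_cyl_le (S : GaussLikeIFS d) {n : ℕ} (ω : Fin n → ℕ+) :
    diam (S.cyl ω) ≤ |S.wordMap (List.ofFn ω) 0 - S.wordMap (List.ofFn ω) 1| := by
  rw [cyl_eq_image]
  refine diam_le_of_forall_dist_le (abs_nonneg _) ?_
  rintro _ ⟨x, hx, rfl⟩ _ ⟨y, hy, rfl⟩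
  rw [Real.dist_eq, abs_sub_comm (S.wordMap _ 0)]
  exact abs_sub_le_of_uIcc_subset_uIcc
    (uIcc_subset_uIcc (S.wordMap_mem_uIcc _ hy) (S.wordMap_mem_uIcc _ hx))

/-- The expansion of a word compares with the size of its cylinder. -/
lemma exists_expands_ge (S : GaussLikeIFS d) {δ c e ρ : ℝ} (hc : 0 < c) (he : 0 < e)
    (he1 : e ≤ 1)
    (hdist : ∀ i : ℕ+, ∀ x ∈ Icc (0 : ℝ) 1, ∀ y ∈ Icc (0 : ℝ) 1,
      c * |S.T' i y| ^ (1 + δ) ≤ |S.T' i x| ∧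
      (|x - y| ≤ ρ → e * |S.T' i y| ^ (1 + δ) ≤ |S.T' i x|))
    {n : ℕ} (hn : ∀ w : List ℕ+, n ≤ w.length → ∀ x ∈ Icc (0 : ℝ) 1, ∀ y ∈ Icc (0 : ℝ) 1,
      |S.wordMap w x - S.wordMap w y| ≤ ρ) (w : List ℕ+) :
    ∃ r, S.Expands w r ∧
      c ^ (min w.length n) * e ^ w.length * |S.wordMap w 0 - S.wordMap w 1| ^ (1 + δ) ≤ r := by
  have h0 : (0 : ℝ) ∈ Icc (0 : ℝ) 1 := by simp
  have h1 : (1 : ℝ) ∈ Icc (0 : ℝ) 1 := by simp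
  induction w with
  | nil => exact ⟨1, S.expands_nil, by simp [wordMap_nil]⟩
  | cons i w ih =>
    obtain ⟨r, hr, hle⟩ := ih
    obtain ⟨z, hz, hzeq⟩ := S.exists_slope i (S.wordMap_mem w h0) (S.wordMap_mem w h1)
    have hsub : uIcc (S.wordMap w 0) (S.wordMap w 1) ⊆ Icc 0 1 :=
      ordConnected_Icc.uIcc_subset (S.wordMap_mem w h0) (S.wordMap_mem w h1)
    have hzp := abs_pos.2 (S.T'_ne_zero i (hsub hz))
    obtain ⟨g, hg0, hg, hgle⟩ : ∃ g, 0 < g ∧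
        (∀ v ∈ uIcc (S.wordMap w 0) (S.wordMap w 1), g * |S.T' i z| ^ (1 + δ) ≤ |S.T' i v|) ∧
        c ^ (min (w.length + 1) n) * e ^ (w.length + 1) ≤
          g * (c ^ (min w.length n) * e ^ w.length) := by
      rcases lt_or_ge w.length n with hl | hl
      · refine ⟨c, hc, fun v hv => (hdist i v (hsub hv) z (hsub hz)).1, ?_⟩
        rw [min_eq_left hl, min_eq_left hl.le, pow_succ c, pow_succ e]
        have : 0 < c ^ w.length * c * e ^ w.length := by positivity
        nlinarith
      · refine ⟨e, he, fun v hv => (hdist i v (hsub hv) z (hsub hz)).2 ?_, ?_⟩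
        · refine le_trans ?_ (hn w hl 1 h1 0 h0)
          exact abs_sub_le_of_uIcc_subset_uIcc (uIcc_subset_uIcc hz hv)
        · rw [min_eq_right hl, min_eq_right (by omega), pow_succ e]
          exact le_of_eq (by ring)
    refine ⟨g * |S.T' i z| ^ (1 + δ) * r, ⟨mul_pos (by positivity) hr.1, fun x hx y hy => ?_⟩, ?_⟩
    · obtain ⟨v, hv, hveq⟩ := S.exists_slope i (S.wordMap_mem w hx) (S.wordMap_mem w hy)
      rw [wordMap_cons, wordMap_cons, hveq, abs_mul, mul_assoc]
      have hv' := uIcc_subset_uIcc (S.wordMap_mem_uIcc w hx) (S.wordMap_mem_uIcc w hy) hv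
      exact mul_le_mul (hg v hv') (hr.2 x hx y hy) (mul_nonneg hr.1.le (abs_nonneg _))
        (abs_nonneg _)
    · rw [wordMap_cons, wordMap_cons, hzeq, abs_mul, List.length_cons,
        Real.mul_rpow hzp.le (abs_nonneg _)]
      have hD : 0 ≤ |S.wordMap w 0 - S.wordMap w 1| ^ (1 + δ) := by positivity
      calc _ ≤ g * (c ^ (min w.length n) * e ^ w.length) *
            (|S.T' i z| ^ (1 + δ) * |S.wordMap w 0 - S.wordMap w 1| ^ (1 + δ)) := by gcongr
        _ = g * |S.T' i z| ^ (1 + δ) * (c ^ (min w.length n) * e ^ w.length *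
            |S.wordMap w 0 - S.wordMap w 1| ^ (1 + δ)) := by ring
        _ ≤ _ := by gcongr

/-- The partition function is approximated from below by finitely many words. -/
lemma exists_finset_of_lt_Pn (S : GaussLikeIFS d) {n : ℕ} (hn : 0 < n) {s L : ℝ} (hL : 0 ≤ L)
    (h : L < S.Pn n s) :
    ∃ F : Finset (Fin n → ℕ+), Real.exp (n * L) < ∑ ω ∈ F, diam (S.cyl ω) ^ s := by
  have hnR : (0 : ℝ) < n := Nat.cast_pos.2 hn
  have hlog : n * L < Real.log (S.Z n s) := by
    rw [Pn, one_div, inv_mul_eq_div, lt_div_iff₀ hnR] at h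
    linarith
  have hZ0 : 0 ≤ S.Z n s := tsum_nonneg fun ω => Real.rpow_nonneg diam_nonneg _
  have hZ : S.Z n s ≠ 0 := by
    intro h0
    rw [h0, Real.log_zero] at hlog
    have : 0 ≤ n * L := by positivity
    linarith
  have hlt := (Real.lt_log_iff_exp_lt (hZ0.lt_of_ne' hZ)).1 hlog
  have hsum : Summable fun ω : Fin n → ℕ+ => diam (S.cyl ω) ^ s := by
    by_contra hns
    exact hZ (tsum_eq_zero_of_not_summable hns)
  exact (hsum.hasSum.eventually (lt_mem_nhds hlt)).exists

lemma Am_mono {s s' : ℝ} (hd : 1 < d) (h : s' ≤ s) {k : ℕ} {b : Fin k → ℝ}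
    (hb : ∀ m, 0 ≤ b m) (m : Fin k) : Am d b s' m ≤ Am d b s m := by
  have h1 : 0 ≤ ∑ j ∈ Finset.Iio m, b j := Finset.sum_nonneg fun j _ => hb j
  have h2 := hb m
  unfold Am
  have h3 : (d - 1) * s' ≤ (d - 1) * s := mul_le_mul_of_nonneg_left h (by linarith)
  have h4 : d * s' ≤ d * s := mul_le_mul_of_nonneg_left h (by linarith)
  gcongr

lemma ofReal_div_le_dimH_Eset (S : GaussLikeIFS d) {s B A L K δ : ℝ} (hs : 0 < s) (hB : 1 < B)
    {k : ℕ} {i : Fin k → ℕ} (hi : StrictMono i) {t : Fin k → ℝ} (ht : ∀ m, 0 < t m)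
    {b : Fin k → ℝ} (hb : b ∈ simplexS t) (hA0 : 0 ≤ A) (hA : ∀ m, Am d b s m ≤ A)
    (hP : ∀ᶠ n : ℕ in atTop, L < S.Pn n s) (hK1 : 1 ≤ K)
    (hK : ∀ i : ℕ+, ∀ x ∈ Icc (0 : ℝ) 1, |S.T' i x| ≤ K) (hδ : 0 < δ)
    (hL : A * Real.log B + s * (δ * (1 + Real.log K)) < L) :
    ENNReal.ofReal (s / (1 + δ)) ≤ dimH (S.Eset B i t) := by
  have hlogB := Real.log_pos hB
  have hlogK := Real.log_nonneg hK1
  have hK0 : 0 < K := by linarith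
  set s' := s / (1 + δ) with hs'
  have hs'0 : 0 < s' := by positivity
  have hs's : s' ≤ s := div_le_self hs.le (by linarith)
  have hss : (1 + δ) * s' = s := mul_div_cancel₀ _ (by positivity)
  obtain ⟨c, ρ, hc, hc1, hρ, hdist⟩ := S.exists_distortion hδ hδ hK1 hK
  obtain ⟨N, hN⟩ := S.exists_length_abs_sub_le hρ
  set e := Real.exp (-δ) * K ^ (-δ) with he
  have he0 : 0 < e := by positivity
  have he1 : e ≤ 1 := mul_le_one₀ (Real.exp_le_one_iff.2 (by linarith)) (by positivity)
    (Real.rpow_le_one_of_one_le_of_nonpos hK1 (by linarith))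
  have hloge : Real.log e = -(δ * (1 + Real.log K)) := by
    rw [he, Real.log_mul (Real.exp_pos _).ne' (by positivity), Real.log_exp,
      Real.log_rpow hK0]
    ring
  choose r hr hrle using S.exists_expands_ge hc he0 he1 hdist hN
  obtain ⟨p, η, hη, hp⟩ := S.exists_interior_digit
  obtain ⟨rp, hrp⟩ := S.exists_expands_singleton p
  have hL0 : 0 ≤ L := by
    have : 0 ≤ A * Real.log B + s * (δ * (1 + Real.log K)) := by positivity
    linarith
  have hgap : 0 < L - s' * (δ * (1 + Real.log K)) - A * Real.log B := by
    have : s' * (δ * (1 + Real.log K)) ≤ s * (δ * (1 + Real.log K)) := by gcongr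
    linarith
  have hlim : Tendsto (fun n : ℕ => (n : ℝ) * (L - s' * (δ * (1 + Real.log K)) - A * Real.log B))
      atTop atTop := tendsto_natCast_atTop_atTop.atTop_mul_const hgap
  obtain ⟨n, hPn, hn, hnlt⟩ := (hP.and ((eventually_gt_atTop 0).and
    (hlim.eventually_gt_atTop
      (A * Real.log B - s' * Real.log rp - s' * (N * Real.log c))))).exists
  obtain ⟨F, hF⟩ := S.exists_finset_of_lt_Pn hn hL0 hPn
  set C := (c ^ N * e ^ n) ^ s' with hC
  have hC0 : 0 < C := by positivity
  have hterm : ∀ ω : Fin n → ℕ+, C * diam (S.cyl ω) ^ s ≤ r (List.ofFn ω) ^ s' := by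
    intro ω
    have h1 := hrle (List.ofFn ω)
    rw [List.length_ofFn] at h1
    have hD : 0 ≤ diam (S.cyl ω) := diam_nonneg
    calc C * diam (S.cyl ω) ^ s = (c ^ N * e ^ n * diam (S.cyl ω) ^ (1 + δ)) ^ s' := by
          rw [Real.mul_rpow (by positivity) (by positivity), ← Real.rpow_mul hD, hss]
      _ ≤ (c ^ (min n N) * e ^ n *
          |S.wordMap (List.ofFn ω) 0 - S.wordMap (List.ofFn ω) 1| ^ (1 + δ)) ^ s' := by
          have h2 := S.diam_cyl_le ω
          have h3 : c ^ N ≤ c ^ (min n N) := pow_le_pow_of_le_one hc.le hc1 (min_le_right _ _)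
          gcongr
      _ ≤ _ := Real.rpow_le_rpow (by positivity) h1 hs'0.le
  have hFne : F.Nonempty := by
    rw [Finset.nonempty_iff_ne_empty]
    rintro rfl
    rw [Finset.sum_empty] at hF
    exact (Real.exp_pos _).not_gt hF
  obtain ⟨st, hlen, hφ⟩ := S.exists_step_of_words hs'0.le hη hp hrp (q := n)
    (F.map ⟨List.ofFn, List.ofFn_injective⟩) hFne.map
    (fun w hw => by
      obtain ⟨ω, -, rfl⟩ := Finset.mem_map.1 hw
      exact List.length_ofFn) r (fun w _ => hr w)
  rw [Finset.sum_map] at hφ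
  have hrps : 0 < rp ^ s' := Real.rpow_pos_of_pos hrp.1 _
  have hlt : rp ^ s' * (C * Real.exp (n * L)) <
      rp ^ s' * ∑ ω ∈ F, r (List.ofFn ω) ^ s' := by
    refine mul_lt_mul_of_pos_left ?_ hrps
    calc C * Real.exp (n * L) < C * ∑ ω ∈ F, diam (S.cyl ω) ^ s := mul_lt_mul_of_pos_left hF hC0
      _ ≤ _ := by
          rw [Finset.mul_sum]
          exact Finset.sum_le_sum fun ω _ => hterm ω
  have hlow : 0 < rp ^ s' * (C * Real.exp (n * L)) := by positivity
  have hloglow : Real.log (rp ^ s' * (C * Real.exp (n * L))) =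
      s' * Real.log rp + s' * (N * Real.log c + n * Real.log e) + n * L := by
    rw [Real.log_mul hrps.ne' (by positivity), Real.log_mul hC0.ne' (Real.exp_pos _).ne',
      Real.log_exp, Real.log_rpow hrp.1, hC, Real.log_rpow (by positivity),
      Real.log_mul (by positivity) (by positivity), Real.log_pow, Real.log_pow]
    ring
  refine S.ofReal_le_dimH_Eset hs'0 hB hi ht hb hA0
    (fun m => (Am_mono S.one_lt_d hs's hb.1 m).trans (hA m)) st
    (by rw [hφ]; exact inv_pos.2 (hlow.trans hlt)) (by omega) ?_
  rw [hφ, hlen, Real.log_inv, neg_neg]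
  refine lt_trans ?_ (Real.log_lt_log hlow hlt)
  rw [hloglow, hloge]
  push_cast
  linarith

/-- Above `1 / d`, the dimension is at least any `s` with `A(s) log B < P(s)`. -/
lemma ofReal_le_dimH_Eset_of_pressure (S : GaussLikeIFS d) {s B Ps : ℝ} (hsd : 1 / d < s)
    (hB : 1 < B) {k : ℕ} (hk : 0 < k) {i : Fin k → ℕ} (hi : StrictMono i) {t : Fin k → ℝ}
    (ht : ∀ m, 0 < t m) (hne : (simplexS t).Nonempty)
    (hP : Tendsto (fun n : ℕ => S.Pn n s) atTop (𝓝 Ps)) (hlt : AS d t s * Real.log B < Ps) :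
    ENNReal.ofReal s ≤ dimH (S.Eset B i t) := by
  have hd := S.one_lt_d
  have hd0 : 0 < d := by linarith
  have hs : 0 < s := (by positivity : (0 : ℝ) < 1 / d).trans hsd
  have hds : 1 < d * s := by
    rwa [div_lt_iff₀' hd0] at hsd
  have hlogB := Real.log_pos hB
  obtain ⟨A, hA1, hA2⟩ := exists_between ((lt_div_iff₀ hlogB).2 hlt)
  rw [lt_div_iff₀ hlogB] at hA2
  obtain ⟨_, ⟨b, hb, rfl⟩, hbA⟩ := exists_lt_of_csInf_lt (hne.image _) hA1
  have hA : ∀ m, Am d b s m ≤ A := fun m =>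
    (le_ciSup (f := fun m => Am d b s m) (Set.finite_range _).bddAbove m).trans hbA.le
  have hA0 : 0 ≤ A := by
    refine le_trans ?_ (hA ⟨0, hk⟩)
    have h1 : 0 ≤ ∑ j ∈ Finset.Iio (⟨0, hk⟩ : Fin k), b j := Finset.sum_nonneg fun j _ => hb.1 j
    have h2 := hb.1 ⟨0, hk⟩
    have h3 : 0 ≤ (d - 1) * s := mul_nonneg (by linarith) hs.le
    unfold Am
    nlinarith [mul_nonneg h3 h2, mul_nonneg (by linarith : 0 ≤ d * s - 1) h1]
  obtain ⟨L, hL1, hL2⟩ := exists_between hA2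
  obtain ⟨K, hK1, hK⟩ := S.exists_abs_T'_le
  have hcont : Tendsto (fun δ : ℝ => A * Real.log B + s * (δ * (1 + Real.log K))) (𝓝[>] 0)
      (𝓝 (A * Real.log B + s * (0 * (1 + Real.log K)))) :=
    (Continuous.tendsto (by fun_prop) 0).mono_left nhdsWithin_le_nhds
  have hev := hcont.eventually (gt_mem_nhds (by simpa using hL1))
  have hdiv : Tendsto (fun δ : ℝ => ENNReal.ofReal (s / (1 + δ))) (𝓝[>] 0)
      (𝓝 (ENNReal.ofReal s)) := by
    have : ContinuousAt (fun δ : ℝ => ENNReal.ofReal (s / (1 + δ))) 0 :=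
      ENNReal.continuous_ofReal.continuousAt.comp
        (continuousAt_const.div (by fun_prop) (by norm_num))
    simpa using this.tendsto.mono_left nhdsWithin_le_nhds
  refine le_of_tendsto hdiv ?_
  filter_upwards [hev, self_mem_nhdsWithin] with δ h1 h2
  exact S.ofReal_div_le_dimH_Eset hs hB hi ht hb hA0 hA (hP.eventually (lt_mem_nhds hL2)) hK1 hK
    h2 h1

end GaussLikeIFS

/-- the Hausdorff dimension of `E` is at least `s₀ = inf{s : P(s) ≤ A(s)·log B}`. -/
theorem dimH_Eset_ge {d : ℝ} (S : GaussLikeIFS d) (B : ℝ) (hB : 1 < B)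
    {k : ℕ} (hk : 0 < k) (i : Fin k → ℕ) (hi : StrictMono i)
    (t : Fin k → ℝ) (ht : ∀ m, 0 < t m)
    (P : ℝ → ℝ)
    (hP : ∀ s : ℝ, 1 / d < s →
      Filter.Tendsto (fun n : ℕ => S.Pn n s) Filter.atTop (nhds (P s))) :
    ENNReal.ofReal (sInf {s : ℝ | P s ≤ AS d t s * Real.log B}) ≤
      dimH (S.Eset B i t) := by
  have hne : (simplexS t).Nonempty := by
    refine ⟨fun m => if m = ⟨0, hk⟩ then 1 / t m else 0, fun m => ?_, ?_⟩
    · have := (ht m).le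
      beta_reduce
      split_ifs <;> positivity
    · simp [(ht ⟨0, hk⟩).ne']
  obtain ⟨b, hb⟩ := hne
  have hbdd : 0 < sInf {s : ℝ | P s ≤ AS d t s * Real.log B} →
      BddBelow {s : ℝ | P s ≤ AS d t s * Real.log B} := by
    intro h
    by_contra hn
    rw [Real.sInf_of_not_bddBelow hn] at h
    exact h.false
  set s₀ := sInf {s : ℝ | P s ≤ AS d t s * Real.log B}
  have key : ∀ s, 0 < s → s ≠ 1 / d → s < s₀ → ENNReal.ofReal s ≤ dimH (S.Eset B i t) := by
    intro s hs hsd hs₀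
    rcases lt_or_gt_of_ne hsd with h | h
    · exact S.ofReal_le_dimH_Eset_of_lt hs h hB hi ht hb
    · refine S.ofReal_le_dimH_Eset_of_pressure h hB hk hi ht ⟨b, hb⟩ (hP s h) ?_
      by_contra! hcon
      exact notMem_of_lt_csInf hs₀ (hbdd (hs.trans hs₀)) hcon
  rcases le_or_gt s₀ 0 with h0 | h0
  · rw [ENNReal.ofReal_of_nonpos h0]
    exact zero_le
  have hlim : Filter.Tendsto ENNReal.ofReal (𝓝[<] s₀) (𝓝 (ENNReal.ofReal s₀)) :=
    ENNReal.continuous_ofReal.continuousAt.tendsto.mono_left nhdsWithin_le_nhds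
  refine le_of_tendsto hlim ?_
  have hne' : ∀ᶠ s in 𝓝[<] s₀, s ≠ 1 / d := by
    rcases lt_or_ge (1 / d) s₀ with h | h
    · filter_upwards [Ioo_mem_nhdsLT h] with s hs using hs.1.ne'
    · filter_upwards [self_mem_nhdsWithin] with s hs using (lt_of_lt_of_le hs h).ne
  filter_upwards [hne', Ioo_mem_nhdsLT h0] with s h1 h2
  exact key s h2.1 h1 h2.2
end
end

section
/- Let {T_n}_{n≥1} be a d-decaying Gauss-like iterated function system. For every s > 1/d there exists z = z(s) > 0 such that for every δ with 0 < δ < (s − 1/d)/2 and every n ∈ ℕ, |P_n(s − δ) − P_n(s)| ≤ z·δ and |P_n(s + δ) − P_n(s)| ≤ z·δ, where P_n(t) = (1/n) log Σ_{ω∈ℕ^n} |C[ω]|^t. -/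
open Set Filter Topology Metric MeasureTheory

noncomputable section

/-- Log-convexity of `t ↦ ∑ D i ^ t`, in Hölder form. -/
theorem tsum_rpow_le_rpow_mul_rpow {ι : Type*} {D : ι → ℝ} (hD : ∀ i, 0 ≤ D i) {a b θ : ℝ}
    (ha : 0 < a) (hb : 0 < b) (hθ₀ : 0 < θ) (hθ₁ : θ < 1)
    (hsa : Summable fun i => D i ^ a) (hsb : Summable fun i => D i ^ b) :
    ∑' i, D i ^ (θ * a + (1 - θ) * b) ≤ (∑' i, D i ^ a) ^ θ * (∑' i, D i ^ b) ^ (1 - θ) := by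
  have hθ₂ : 0 < 1 - θ := by linarith
  have e₁ : ∀ i, (D i ^ (θ * a)) ^ θ⁻¹ = D i ^ a := fun i => by
    rw [← Real.rpow_mul (hD i)]; congr 1; field_simp
  have e₂ : ∀ i, (D i ^ ((1 - θ) * b)) ^ (1 - θ)⁻¹ = D i ^ b := fun i => by
    rw [← Real.rpow_mul (hD i)]; congr 1; field_simp
  have key := Real.inner_le_Lp_mul_Lq_tsum_of_nonneg
    (Real.HolderConjugate.inv_one_sub_inv hθ₀ hθ₁)
    (fun i => Real.rpow_nonneg (hD i) (θ * a)) (fun i => Real.rpow_nonneg (hD i) ((1 - θ) * b))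
    (by simpa only [e₁] using hsa) (by simpa only [e₂] using hsb)
  simp only [e₁, e₂, one_div, inv_inv] at key
  refine le_of_eq_of_le (tsum_congr fun i => ?_) key
  exact Real.rpow_add_of_nonneg (hD i) (by positivity) (by positivity)

/-- The sum over words of length `n` of a product of nonnegative letter weights. -/
theorem hasSum_prod_fin {α : Type*} {f : α → ℝ} (hf : ∀ i, 0 ≤ f i) (hs : Summable f) (n : ℕ) :
    HasSum (fun ω : Fin n → α => ∏ j, f (ω j)) ((∑' i, f i) ^ n) := by
  induction n with
  | zero => simp
  | succ n ih =>
    have hm : Summable fun p : α × (Fin n → α) => f p.1 * ∏ j, f (p.2 j) :=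
      Summable.mul_of_nonneg (g := fun ω : Fin n → α => ∏ j, f (ω j)) hs ih.summable hf
        fun ω => Finset.prod_nonneg fun j _ => hf (ω j)
    let e : α × (Fin n → α) ≃ (Fin (n + 1) → α) := Fin.consEquiv fun _ => α
    have he : (fun ω : Fin (n + 1) → α => ∏ j, f (ω j)) ∘ e =
        fun p => f p.1 * ∏ j, f (p.2 j) := by
      funext p
      simp [e, Fin.consEquiv, Fin.prod_univ_succ]
    rw [← e.hasSum_iff, he, pow_succ']
    exact HasSum.mul (g := fun ω : Fin n → α => ∏ j, f (ω j)) hs.hasSum ih hm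

theorem chainMap_succ (T : ℕ+ → ℝ → ℝ) {n : ℕ} (ω : Fin (n + 1) → ℕ+) (x : ℝ) :
    chainMap T ω x = T (ω 0) (chainMap T (fun j => ω j.succ) x) := by
  simp [chainMap, List.ofFn_succ]

namespace GaussLikeIFS

variable {d : ℝ} (S : GaussLikeIFS d)

theorem abs_T_sub_le {i : ℕ+} {C : ℝ} (hC : ∀ x ∈ Icc (0 : ℝ) 1, |S.T' i x| ≤ C) {x y : ℝ}
    (hx : x ∈ Icc (0 : ℝ) 1) (hy : y ∈ Icc (0 : ℝ) 1) :
    |S.T i y - S.T i x| ≤ C * |y - x| :=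
  (convex_Icc (0 : ℝ) 1).norm_image_sub_le_of_norm_hasDerivWithin_le (S.hasDeriv i) hC hx hy

theorem le_abs_T_sub {i : ℕ+} {c : ℝ} (hc : ∀ x ∈ Icc (0 : ℝ) 1, c ≤ |S.T' i x|) {x y : ℝ}
    (hx : x ∈ Icc (0 : ℝ) 1) (hy : y ∈ Icc (0 : ℝ) 1) :
    c * |y - x| ≤ |S.T i y - S.T i x| := by
  wlog hxy : x < y generalizing x y
  · rcases (not_lt.mp hxy).eq_or_lt with rfl | h
    · simp
    · rw [abs_sub_comm y, abs_sub_comm (S.T i y)]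
      exact this hy hx h
  obtain ⟨z, hz, h⟩ := exists_hasDerivAt_eq_slope (S.T i) (S.T' i) hxy
    (fun z hz => ((S.hasDeriv i z ⟨hx.1.trans hz.1, hz.2.trans hy.2⟩).continuousWithinAt).mono
      (Icc_subset_Icc hx.1 hy.2))
    (fun z hz => (S.hasDeriv i z ⟨hx.1.trans hz.1.le, hz.2.le.trans hy.2⟩).hasDerivAt
      (Icc_mem_nhds (hx.1.trans_lt hz.1) (hz.2.trans_le hy.2)))
  have hne : y - x ≠ 0 := (sub_pos.mpr hxy).ne'
  rw [eq_div_iff hne] at h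
  rw [← h, abs_mul]
  exact mul_le_mul_of_nonneg_right (hc z ⟨hx.1.trans hz.1.le, hz.2.le.trans hy.2⟩) (abs_nonneg _)

theorem chainMap_mem {n : ℕ} (ω : Fin n → ℕ+) {x : ℝ} (hx : x ∈ Icc (0 : ℝ) 1) :
    chainMap S.T ω x ∈ Icc (0 : ℝ) 1 := by
  induction n with
  | zero => simpa [chainMap] using hx
  | succ n ih => rw [chainMap_succ]; exact S.maps_to _ (ih _)

theorem abs_chainMap_sub_le {w : ℕ+ → ℝ} (hw : ∀ i, ∀ x ∈ Icc (0 : ℝ) 1, |S.T' i x| ≤ w i)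
    {n : ℕ} (ω : Fin n → ℕ+) {x y : ℝ} (hx : x ∈ Icc (0 : ℝ) 1) (hy : y ∈ Icc (0 : ℝ) 1) :
    |chainMap S.T ω y - chainMap S.T ω x| ≤ (∏ j, w (ω j)) * |y - x| := by
  induction n with
  | zero => simp [chainMap]
  | succ n ih =>
    rw [chainMap_succ, chainMap_succ, Fin.prod_univ_succ, mul_assoc]
    refine (S.abs_T_sub_le (hw _) (S.chainMap_mem _ hx) (S.chainMap_mem _ hy)).trans ?_
    exact mul_le_mul_of_nonneg_left (ih _)
      ((abs_nonneg _).trans (hw (ω 0) 0 (by simp)))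

theorem le_abs_chainMap_sub {i : ℕ+} {c : ℝ} (hc₀ : 0 ≤ c)
    (hc : ∀ x ∈ Icc (0 : ℝ) 1, c ≤ |S.T' i x|) (n : ℕ) {x y : ℝ}
    (hx : x ∈ Icc (0 : ℝ) 1) (hy : y ∈ Icc (0 : ℝ) 1) :
    c ^ n * |y - x| ≤
      |chainMap S.T (fun _ : Fin n => i) y - chainMap S.T (fun _ : Fin n => i) x| := by
  induction n with
  | zero => simp [chainMap]
  | succ n ih =>
    rw [chainMap_succ, chainMap_succ, pow_succ', mul_assoc]
    exact (mul_le_mul_of_nonneg_left ih hc₀).trans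
      (S.le_abs_T_sub hc (S.chainMap_mem _ hx) (S.chainMap_mem _ hy))

theorem cyl_subset {n : ℕ} (ω : Fin n → ℕ+) : S.cyl ω ⊆ Icc (0 : ℝ) 1 := by
  rintro _ ⟨x, hx, rfl⟩
  exact S.chainMap_mem ω hx

theorem diam_cyl_le_one {n : ℕ} (ω : Fin n → ℕ+) : diam (S.cyl ω) ≤ 1 := by
  simpa [Real.diam_Icc] using diam_mono (S.cyl_subset ω) (isBounded_Icc 0 1)

theorem diam_cyl_le_prod {w : ℕ+ → ℝ} (hw : ∀ i, ∀ x ∈ Icc (0 : ℝ) 1, |S.T' i x| ≤ w i)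
    {n : ℕ} (ω : Fin n → ℕ+) : diam (S.cyl ω) ≤ ∏ j, w (ω j) := by
  have hp : 0 ≤ ∏ j, w (ω j) :=
    Finset.prod_nonneg fun j _ => (abs_nonneg _).trans (hw (ω j) 0 (by simp))
  refine diam_le_of_forall_dist_le hp ?_
  rintro _ ⟨x, hx, rfl⟩ _ ⟨y, hy, rfl⟩
  rw [Real.dist_eq]
  refine (S.abs_chainMap_sub_le hw ω hy hx).trans (mul_le_of_le_one_right hp ?_)
  rw [abs_le]
  constructor <;> linarith [hx.1, hx.2, hy.1, hy.2]

theorem pow_le_diam_cyl_const {i : ℕ+} {c : ℝ} (hc₀ : 0 ≤ c)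
    (hc : ∀ x ∈ Icc (0 : ℝ) 1, c ≤ |S.T' i x|) (n : ℕ) :
    c ^ n ≤ diam (S.cyl fun _ : Fin n => i) := by
  have h := S.le_abs_chainMap_sub hc₀ hc n (x := 0) (y := 1) (by simp) (by simp)
  rw [sub_zero, abs_one, mul_one, ← Real.dist_eq] at h
  exact h.trans (dist_le_diam_of_mem ((isBounded_Icc 0 1).subset (S.cyl_subset _))
    (mem_image_of_mem _ (by simp)) (mem_image_of_mem _ (by simp)))

/-- Letter weights dominating the derivatives, whose `t`-th powers are summable. -/
theorem exists_summable_weight {t : ℝ} (ht : 1 / d < t) :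
    ∃ w : ℕ+ → ℝ, (∀ i, ∀ x ∈ Icc (0 : ℝ) 1, |S.T' i x| ≤ w i) ∧
      Summable fun i => w i ^ t := by
  have hd : 0 < d := one_pos.trans S.one_lt_d
  have ht₀ : 0 < t := (one_div_pos.mpr hd).trans ht
  have hdt : 1 < d * t := by rwa [div_lt_iff₀' hd] at ht
  have hε : 0 < (d * t - 1) / (2 * t) := div_pos (by linarith) (by linarith)
  obtain ⟨K₁, K₂, -, hK₂, h⟩ := S.decay _ hε
  refine ⟨fun i => K₂ * ((i : ℕ) : ℝ) ^ (-(d - (d * t - 1) / (2 * t))), fun i x hx => ?_, ?_⟩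
  · obtain ⟨ζ, l, hb, -, -, hl⟩ := h i
    exact (hb x hx).2.trans hl
  · have hexp : -(d - (d * t - 1) / (2 * t)) * t < -1 := by
      have : -(d - (d * t - 1) / (2 * t)) * t = -((d * t + 1) / 2) := by field_simp; ring
      rw [this]; linarith
    refine (((Real.summable_nat_rpow.mpr hexp).comp_injective PNat.coe_injective).mul_left
      (K₂ ^ t)).congr fun i => ?_
    rw [Real.mul_rpow hK₂.le (by positivity), ← Real.rpow_mul (by positivity)]
    rfl

/-- A letter whose map has derivative bounded away from `0`. -/
theorem exists_pos_le_abs_deriv :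
    ∃ c : ℝ, 0 < c ∧ ∀ x ∈ Icc (0 : ℝ) 1, c ≤ |S.T' 1 x| := by
  obtain ⟨K₁, K₂, hK₁, -, h⟩ := S.decay 1 one_pos
  obtain ⟨ζ, l, hb, hζ, -, -⟩ := h 1
  refine ⟨K₁, hK₁, fun x hx => le_trans ?_ (hb x hx).1⟩
  simpa using hζ

theorem summable_and_Z_le {w : ℕ+ → ℝ} (hw : ∀ i, ∀ x ∈ Icc (0 : ℝ) 1, |S.T' i x| ≤ w i)
    {t : ℝ} (ht : 0 ≤ t) (hs : Summable fun i => w i ^ t) (n : ℕ) :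
    (Summable fun ω : Fin n → ℕ+ => diam (S.cyl ω) ^ t) ∧ S.Z n t ≤ (∑' i, w i ^ t) ^ n := by
  have hw₀ : ∀ i, 0 ≤ w i := fun i => (abs_nonneg _).trans (hw i 0 (by simp))
  have h := hasSum_prod_fin (fun i => Real.rpow_nonneg (hw₀ i) t) hs n
  have hle : ∀ ω : Fin n → ℕ+, diam (S.cyl ω) ^ t ≤ ∏ j, w (ω j) ^ t := fun ω => by
    rw [Real.finsetProd_rpow _ _ fun j _ => hw₀ (ω j)]
    exact Real.rpow_le_rpow diam_nonneg (S.diam_cyl_le_prod hw ω) ht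
  have hsum := h.summable.of_nonneg_of_le (fun ω => Real.rpow_nonneg diam_nonneg t) hle
  exact ⟨hsum, h.tsum_eq ▸ hsum.tsum_le_tsum hle h.summable⟩

theorem summable_diam_rpow {t : ℝ} (ht : 1 / d < t) (n : ℕ) :
    Summable fun ω : Fin n → ℕ+ => diam (S.cyl ω) ^ t := by
  obtain ⟨w, hw, hs⟩ := S.exists_summable_weight ht
  have hd : 0 < d := one_pos.trans S.one_lt_d
  exact (S.summable_and_Z_le hw ((one_div_pos.mpr hd).trans ht).le hs n).1

theorem pow_rpow_le_Z {c : ℝ} (hc₀ : 0 < c) (hc : ∀ x ∈ Icc (0 : ℝ) 1, c ≤ |S.T' 1 x|)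
    {t : ℝ} (ht : 1 / d < t) (n : ℕ) : (c ^ n) ^ t ≤ S.Z n t := by
  have hd : 0 < d := one_pos.trans S.one_lt_d
  refine (Real.rpow_le_rpow (by positivity) (S.pow_le_diam_cyl_const hc₀.le hc n)
    ((one_div_pos.mpr hd).trans ht).le).trans ?_
  exact (S.summable_diam_rpow ht n).le_tsum (fun _ : Fin n => (1 : ℕ+))
    fun ω _ => Real.rpow_nonneg diam_nonneg t

theorem Z_pos {t : ℝ} (ht : 1 / d < t) (n : ℕ) : 0 < S.Z n t := by
  obtain ⟨c, hc₀, hc⟩ := S.exists_pos_le_abs_deriv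
  exact (by positivity : 0 < (c ^ n) ^ t).trans_le (S.pow_rpow_le_Z hc₀ hc ht n)

theorem Pn_antitone {u v : ℝ} (hu : 1 / d < u) (huv : u ≤ v) (n : ℕ) : S.Pn n v ≤ S.Pn n u := by
  have hd : 0 < d := one_pos.trans S.one_lt_d
  refine mul_le_mul_of_nonneg_left ?_ (by positivity)
  refine Real.log_le_log (S.Z_pos (hu.trans_le huv) n) ?_
  exact (S.summable_diam_rpow (hu.trans_le huv) n).tsum_le_tsum
    (fun ω => Real.rpow_le_rpow_of_exponent_ge' diam_nonneg (S.diam_cyl_le_one ω)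
      ((one_div_pos.mpr hd).trans hu).le huv) (S.summable_diam_rpow hu n)

theorem Pn_convex {a b θ : ℝ} (ha : 1 / d < a) (hb : 1 / d < b) (hθ₀ : 0 < θ) (hθ₁ : θ < 1)
    (n : ℕ) : S.Pn n (θ * a + (1 - θ) * b) ≤ θ * S.Pn n a + (1 - θ) * S.Pn n b := by
  have hd : 0 < 1 / d := one_div_pos.mpr (one_pos.trans S.one_lt_d)
  have h := tsum_rpow_le_rpow_mul_rpow (fun ω : Fin n → ℕ+ => diam_nonneg (s := S.cyl ω))
    (hd.trans ha) (hd.trans hb) hθ₀ hθ₁ (S.summable_diam_rpow ha n) (S.summable_diam_rpow hb n)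
  have hab : 1 / d < θ * a + (1 - θ) * b := by nlinarith
  have hlog := Real.log_le_log (S.Z_pos hab n) h
  have hA := S.Z_pos ha n
  have hB := S.Z_pos hb n
  change Real.log _ ≤ Real.log (S.Z n a ^ θ * S.Z n b ^ (1 - θ)) at hlog
  rw [Real.log_mul (Real.rpow_pos_of_pos hA _).ne' (Real.rpow_pos_of_pos hB _).ne',
    Real.log_rpow hA, Real.log_rpow hB] at hlog
  have := mul_le_mul_of_nonneg_left hlog (by positivity : (0 : ℝ) ≤ 1 / n)
  unfold Pn
  linarith

theorem exists_Pn_le {t : ℝ} (ht : 1 / d < t) : ∃ A : ℝ, ∀ n : ℕ, 0 < n → S.Pn n t ≤ A := by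
  obtain ⟨w, hw, hs⟩ := S.exists_summable_weight ht
  have hd : 0 < d := one_pos.trans S.one_lt_d
  refine ⟨Real.log (∑' i, w i ^ t), fun n hn => ?_⟩
  have h := Real.log_le_log (S.Z_pos ht n)
    (S.summable_and_Z_le hw ((one_div_pos.mpr hd).trans ht).le hs n).2
  rw [Real.log_pow] at h
  have hn' : (0 : ℝ) < n := by exact_mod_cast hn
  rw [Pn, one_div_mul_eq_div, div_le_iff₀' hn']
  exact h

theorem exists_le_Pn {t : ℝ} (ht : 1 / d < t) : ∃ B : ℝ, ∀ n : ℕ, 0 < n → B ≤ S.Pn n t := by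
  obtain ⟨c, hc₀, hc⟩ := S.exists_pos_le_abs_deriv
  refine ⟨t * Real.log c, fun n hn => ?_⟩
  have h := Real.log_le_log (by positivity) (S.pow_rpow_le_Z hc₀ hc ht n)
  rw [Real.log_rpow (by positivity), Real.log_pow] at h
  have hn' : (0 : ℝ) < n := by exact_mod_cast hn
  rw [Pn, one_div_mul_eq_div, le_div_iff₀' hn']
  linarith

/-- Comparison of slopes for the convex function `Pn n`. -/
theorem slope_Pn_le {t u v : ℝ} (ht : 1 / d < t) (htu : t < u) (huv : u < v) (n : ℕ) :
    (u - t) * (S.Pn n u - S.Pn n v) ≤ (v - u) * (S.Pn n t - S.Pn n u) := by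
  have hvt : 0 < v - t := by linarith
  have h := S.Pn_convex ht (ht.trans (htu.trans huv)) (div_pos (sub_pos.mpr huv) hvt)
    ((div_lt_one hvt).mpr (by linarith)) n
  have e : (v - u) / (v - t) * t + (1 - (v - u) / (v - t)) * v = u := by field_simp; ring
  have e' : (v - u) / (v - t) * S.Pn n t + (1 - (v - u) / (v - t)) * S.Pn n v =
      ((v - u) * S.Pn n t + (u - t) * S.Pn n v) / (v - t) := by field_simp; ring
  rw [e, e', le_div_iff₀ hvt] at h
  linarith

end GaussLikeIFS

/-- uniform Lipschitz estimate for the functions `P_n`. -/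
theorem Pn_uniform_lipschitz {d : ℝ} (S : GaussLikeIFS d) :
    ∀ s : ℝ, 1 / d < s → ∃ z : ℝ, 0 < z ∧
      ∀ δ : ℝ, 0 < δ → δ < (s - 1 / d) / 2 → ∀ n : ℕ, 0 < n →
        |S.Pn n (s - δ) - S.Pn n s| ≤ z * δ ∧
        |S.Pn n (s + δ) - S.Pn n s| ≤ z * δ := by
  intro s hs
  set r := s - 1 / d with hr
  have hr₀ : 0 < r := sub_pos.mpr hs
  have ht : 1 / d < s - 3 * r / 4 := by linarith
  obtain ⟨A, hA⟩ := S.exists_Pn_le ht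
  obtain ⟨B, hB⟩ := S.exists_le_Pn hs
  have hAB : B ≤ A := (hB 1 one_pos).trans
    ((S.Pn_antitone ht (by linarith) 1).trans (hA 1 one_pos))
  have key : ∀ u v : ℝ, s - r / 2 ≤ u → u ≤ s → u < v → ∀ n : ℕ, 0 < n →
      |S.Pn n u - S.Pn n v| ≤ (4 / r * (A - B + 1)) * (v - u) := by
    intro u v hu hus huv n hn
    have hu' : 1 / d < u := by linarith
    rw [abs_of_nonneg (sub_nonneg.mpr (S.Pn_antitone hu' huv.le n))]
    have h₁ := S.slope_Pn_le ht (by linarith : s - 3 * r / 4 < u) huv n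
    have h₂ : S.Pn n (s - 3 * r / 4) - S.Pn n u ≤ A - B + 1 := by
      linarith [hA n hn, hB n hn, S.Pn_antitone hu' hus n]
    have h₃ : r / 4 * (S.Pn n u - S.Pn n v) ≤ (u - (s - 3 * r / 4)) * (S.Pn n u - S.Pn n v) :=
      mul_le_mul_of_nonneg_right (by linarith) (sub_nonneg.mpr (S.Pn_antitone hu' huv.le n))
    have h₄ := mul_le_mul_of_nonneg_left h₂ (sub_nonneg.mpr huv.le)
    have e : 4 / r * (A - B + 1) * (v - u) = ((v - u) * (A - B + 1)) / (r / 4) := by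
      field_simp
    rw [e, le_div_iff₀' (by positivity)]
    linarith
  refine ⟨4 / r * (A - B + 1), mul_pos (by positivity) (by linarith), fun δ hδ hδr n hn => ?_⟩
  refine ⟨?_, ?_⟩
  · simpa using key (s - δ) s (by linarith) (by linarith) (by linarith) n hn
  · rw [abs_sub_comm]
    simpa using key s (s + δ) (by linarith) le_rfl (by linarith) n hn
end
end
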